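/- Let 1 ≤ p, q < ∞ with conjugate exponents p', q'. Let K be a tempered distribution on ℝ^d whose Fourier transform has compact support, and for Schwartz f define T_K f = f * K. Then: (i) T_K extends to a continuous linear operator from L^{p,q}(ℝ^d) to the space of tempered distributions if and only if K ∈ L^{p',q'}(ℝ^d); (ii) if K ∈ L^{p',q'}(ℝ^d), then for every f ∈ L^{p,q}(ℝ^d) the function x ↦ sup_{t>0} |(t^d K(t·)) * f(x)| is Borel measurable (each convolution (t^d K(t·)) * f being a bounded continuous function). -/

import Mathlib

open MeasureTheory Filter Set Complex SchwartzMap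
open scoped ENNReal NNReal Topology SchwartzMap

noncomputable section

abbrev Ed (d : ℕ) : Type := EuclideanSpace ℝ (Fin d)

/-- distribution function -/
def distribFn {α : Type*} [MeasurableSpace α] (μ : Measure α) (f : α → ℂ) (s : ℝ≥0∞) : ℝ≥0∞ :=
  μ {x | s < (‖f x‖₊ : ℝ≥0∞)}

/-- decreasing rearrangement -/
def rearrangement {α : Type*} [MeasurableSpace α] (μ : Measure α) (f : α → ℂ) (t : ℝ) : ℝ≥0∞ :=
  sInf {s : ℝ≥0∞ | distribFn μ f s ≤ ENNReal.ofReal t}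

/-- Lorentz quasinorm `L^{p,q}` (allowing `p = ∞`, where `t^{1/p} = 1`) -/
def lorentzNorm {α : Type*} [MeasurableSpace α] (μ : Measure α) (p q : ℝ≥0∞)
    (f : α → ℂ) : ℝ≥0∞ :=
  if q = ∞ then ⨆ t : Ioi (0:ℝ), ENNReal.ofReal ((t : ℝ) ^ (1/p).toReal) * rearrangement μ f t
  else (∫⁻ t in Ioi (0:ℝ),
    (ENNReal.ofReal (t ^ (1/p).toReal) * rearrangement μ f t) ^ q.toReal / ENNReal.ofReal t) ^
      (1 / q.toReal)

lemma hasTemperateGrowth_const_sub {E : Type*} [NormedAddCommGroup E] [NormedSpace ℝ E]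
    (x : E) : Function.HasTemperateGrowth (fun y : E => x - y) := by
  apply Function.HasTemperateGrowth.of_fderiv (k := 1) (C := ‖x‖ + 1)
  · have h : (fderiv ℝ (fun y : E => x - y)) = fun _ => -(ContinuousLinearMap.id ℝ E) := by
      funext y
      rw [fderiv_const_sub, fderiv_id']
    rw [h]
    exact Function.HasTemperateGrowth.const _
  · exact (differentiable_const x).sub differentiable_id
  · intro y
    have h1 : ‖x - y‖ ≤ ‖x‖ + ‖y‖ := norm_sub_le x y
    have h2 : (0:ℝ) ≤ ‖x‖ := norm_nonneg x
    have h3 : (0:ℝ) ≤ ‖y‖ := norm_nonneg y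
    nlinarith

/-- The continuous linear map `f ↦ f(x - ·)` on Schwartz space. -/
def reflectTranslate {E : Type*} [NormedAddCommGroup E] [NormedSpace ℝ E] (x : E) :
    𝓢(E, ℂ) →L[ℝ] 𝓢(E, ℂ) :=
  SchwartzMap.compCLM ℝ (hasTemperateGrowth_const_sub x)
    ⟨1, ‖x‖ + 1, fun y => by
      have h1 : ‖y‖ ≤ ‖x‖ + ‖x - y‖ := by
        calc ‖y‖ = ‖x - (x - y)‖ := by rw [sub_sub_cancel]
        _ ≤ ‖x‖ + ‖x - y‖ := norm_sub_le _ _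
      have h2 : (0:ℝ) ≤ ‖x‖ := norm_nonneg x
      have h3 : (0:ℝ) ≤ ‖x - y‖ := norm_nonneg _
      nlinarith⟩

/-- convolution of a tempered distribution `K` with a Schwartz function `f`:
`(f * K)(x) = K(f(x - ·))`. -/
def TK {d : ℕ} (K : 𝓢(Ed d, ℂ) →L[ℂ] ℂ) (f : 𝓢(Ed d, ℂ)) (x : Ed d) : ℂ :=
  K (reflectTranslate x f)

section Swap
open FourierTransform LineDeriv

lemma lineDeriv_conv {d : ℕ} (g h : 𝓢(Ed d, ℂ)) (m : Ed d) :
    ∂_{m} (SchwartzMap.convolution (ContinuousLinearMap.mul ℂ ℂ) g h) =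
      SchwartzMap.convolution (ContinuousLinearMap.mul ℂ ℂ) g (∂_{m} h) := by
  have hinj : Function.Injective (fun φ : 𝓢(Ed d, ℂ) => 𝓕 φ) := by
    intro a b hab
    have := congrArg (fun φ : 𝓢(Ed d, ℂ) => 𝓕⁻ φ) hab
    simpa using this
  apply hinj
  have hT : (inner ℝ · m : Ed d → ℝ).HasTemperateGrowth := ((innerSL ℝ).flip m).hasTemperateGrowth
  ext x
  simp [SchwartzMap.fourier_lineDerivOp_eq, SchwartzMap.fourier_convolution, hT]
  ring

lemma iteratedLineDeriv_conv {d : ℕ} (g h : 𝓢(Ed d, ℂ)) {n : ℕ} (m : Fin n → Ed d) :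
    ∂^{m} (SchwartzMap.convolution (ContinuousLinearMap.mul ℂ ℂ) g h) =
      SchwartzMap.convolution (ContinuousLinearMap.mul ℂ ℂ) g (∂^{m} h) := by
  induction n with
  | zero => simp
  | succ n ih => rw [iteratedLineDerivOp_succ_left, ih, lineDeriv_conv, iteratedLineDerivOp_succ_left]

lemma reflectTranslate_apply {d : ℕ} (x y : Ed d) (f : 𝓢(Ed d, ℂ)) :
    reflectTranslate x f y = f (x - y) := rfl

lemma iteratedFDeriv_reflectTranslate {d : ℕ} (f : 𝓢(Ed d, ℂ)) (x y : Ed d) (l : ℕ) :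
    iteratedFDeriv ℝ l (reflectTranslate x f) y =
      iteratedFDeriv ℝ l (reflectTranslate 0 f) (y - x) := by
  have : (⇑(reflectTranslate x f) : Ed d → ℂ) = fun z => reflectTranslate 0 f (z - x) := by
    funext z; simp [reflectTranslate_apply]
  rw [this, iteratedFDeriv_comp_sub]


/-- index type for the Banach space -/
abbrev Ix (d : ℕ) (s : Finset (ℕ × ℕ)) : Type := Σ i : s, Ed d × (Fin i.1.2 → Ed d)

/-- coordinates -/
def wdv {d : ℕ} {s : Finset (ℕ × ℕ)} (φ : 𝓢(Ed d, ℂ)) (j : Ix d s) : ℂ :=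
  ((‖j.2.1‖ ^ j.1.1.1 * (∏ r, ‖j.2.2 r‖)⁻¹ : ℝ) : ℂ) * iteratedFDeriv ℝ j.1.1.2 φ j.2.1 j.2.2

lemma wdv_sub {d : ℕ} {s : Finset (ℕ × ℕ)} (φ ψ : 𝓢(Ed d, ℂ)) (j : Ix d s) :
    ‖wdv φ j - wdv ψ j‖ ≤
      ‖j.2.1‖ ^ j.1.1.1 * ‖iteratedFDeriv ℝ j.1.1.2 φ j.2.1 - iteratedFDeriv ℝ j.1.1.2 ψ j.2.1‖ := by
  unfold wdv
  rw [← mul_sub, norm_mul, Complex.norm_real, norm_mul, norm_pow, norm_norm, mul_assoc]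
  gcongr
  have h := (iteratedFDeriv ℝ j.1.1.2 φ j.2.1 - iteratedFDeriv ℝ j.1.1.2 ψ j.2.1).le_opNorm j.2.2
  rw [ContinuousMultilinearMap.sub_apply] at h
  have h0 : 0 ≤ ∏ r, ‖j.2.2 r‖ := Finset.prod_nonneg fun _ _ => norm_nonneg _
  rw [norm_inv, Real.norm_of_nonneg h0]
  rcases h0.eq_or_lt with h1 | h1
  · rw [← h1]; simp
  · rw [inv_mul_le_iff₀ h1, mul_comm]; exact h

lemma wdv_le {d : ℕ} {s : Finset (ℕ × ℕ)} (φ : 𝓢(Ed d, ℂ)) (j : Ix d s) :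
    ‖wdv φ j‖ ≤ ‖j.2.1‖ ^ j.1.1.1 * ‖iteratedFDeriv ℝ j.1.1.2 φ j.2.1‖ := by
  have := wdv_sub φ 0 j
  have h0 : iteratedFDeriv ℝ j.1.1.2 (⇑(0 : 𝓢(Ed d, ℂ))) j.2.1 = 0 := by
    have : (⇑(0 : 𝓢(Ed d, ℂ)) : Ed d → ℂ) = 0 := rfl
    rw [this]; change iteratedFDeriv ℝ j.1.1.2 (fun _ => (0:ℂ)) j.2.1 = 0
    rw [iteratedFDeriv_fun_zero]; rfl
  have h1 : wdv 0 j = 0 := by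
    unfold wdv; rw [h0]; simp
  simpa [h0, h1] using this

lemma wdv_memlp {d : ℕ} (s : Finset (ℕ × ℕ)) (φ : 𝓢(Ed d, ℂ)) :
    Memℓp (wdv (s := s) φ) ∞ := by
  apply memℓp_infty
  refine ⟨∑ i : s, SchwartzMap.seminorm ℂ i.1.1 i.1.2 φ, ?_⟩
  rintro _ ⟨j, rfl⟩
  refine (wdv_le φ j).trans ((SchwartzMap.le_seminorm ℂ _ _ φ _).trans ?_)
  exact Finset.single_le_sum (f := fun i : s => SchwartzMap.seminorm ℂ i.1.1 i.1.2 φ)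
    (fun i _ => apply_nonneg _ _) (Finset.mem_univ j.1)

/-- the Banach space -/
abbrev Bn (d : ℕ) (s : Finset (ℕ × ℕ)) := lp (fun _ : Ix d s => ℂ) ∞

/-- the map into a Banach space -/
def Wd {d : ℕ} (s : Finset (ℕ × ℕ)) : 𝓢(Ed d, ℂ) →ₗ[ℂ] Bn d s where
  toFun φ := ⟨wdv φ, wdv_memlp s φ⟩
  map_add' φ ψ := by
    ext j
    have h1 : ContDiffAt ℝ j.1.1.2 φ j.2.1 := (φ.smooth _).contDiffAt
    have h2 : ContDiffAt ℝ j.1.1.2 ψ j.2.1 := (ψ.smooth _).contDiffAt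
    have e : iteratedFDeriv ℝ j.1.1.2 (⇑(φ + ψ)) j.2.1 =
      iteratedFDeriv ℝ j.1.1.2 φ j.2.1 + iteratedFDeriv ℝ j.1.1.2 ψ j.2.1 :=
      iteratedFDeriv_add_apply h1 h2
    change wdv (φ + ψ) j = wdv φ j + wdv ψ j
    unfold wdv
    rw [e, ContinuousMultilinearMap.add_apply]; ring
  map_smul' c φ := by
    ext j
    have h1 : ContDiffAt ℝ j.1.1.2 φ j.2.1 := (φ.smooth _).contDiffAt
    have e : iteratedFDeriv ℝ j.1.1.2 (⇑(c • φ)) j.2.1 = c • iteratedFDeriv ℝ j.1.1.2 φ j.2.1 :=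
      iteratedFDeriv_const_smul_apply h1
    change wdv (c • φ) j = c * wdv φ j
    unfold wdv
    rw [e, ContinuousMultilinearMap.smul_apply, smul_eq_mul]; ring

lemma Wd_apply {d : ℕ} (s : Finset (ℕ × ℕ)) (φ : 𝓢(Ed d, ℂ)) (j : Ix d s) :
    (Wd s φ : ∀ _, ℂ) j = wdv φ j := rfl

lemma Wd_norm {d : ℕ} (s : Finset (ℕ × ℕ)) (φ : 𝓢(Ed d, ℂ)) (i : s) :
    SchwartzMap.seminorm ℂ i.1.1 i.1.2 φ ≤ ‖Wd s φ‖ := by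
  apply SchwartzMap.seminorm_le_bound _ _ _ _ (norm_nonneg _)
  intro y
  have h : ‖((‖y‖ ^ i.1.1 : ℝ) : ℂ) • iteratedFDeriv ℝ i.1.2 φ y‖ ≤ ‖Wd s φ‖ := by
    apply ContinuousMultilinearMap.opNorm_le_bound (norm_nonneg _)
    intro m
    have h1 := lp.norm_apply_le_norm (by simp) (Wd s φ) ⟨i, y, m⟩
    rw [Wd_apply, wdv] at h1
    have h0 : 0 ≤ ∏ r, ‖m r‖ := Finset.prod_nonneg fun _ _ => norm_nonneg _
    rw [ContinuousMultilinearMap.smul_apply, smul_eq_mul]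
    rcases h0.eq_or_lt with h2 | h2
    · obtain ⟨r, -, hr⟩ := Finset.prod_eq_zero_iff.1 h2.symm
      rw [(iteratedFDeriv ℝ i.1.2 φ y).map_coord_zero r (by simpa using hr)]
      simp [← h2]
    · have e : ((‖y‖ ^ i.1.1 : ℝ) : ℂ) * iteratedFDeriv ℝ i.1.2 φ y m = ((∏ r, ‖m r‖ : ℝ) : ℂ) *
        (((‖y‖ ^ i.1.1 * (∏ r, ‖m r‖)⁻¹ : ℝ) : ℂ) * iteratedFDeriv ℝ i.1.2 φ y m) := by
        have : ((∏ r, ‖m r‖ : ℝ) : ℂ) ≠ 0 := by exact_mod_cast h2.ne'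
        rw [Complex.ofReal_mul, Complex.ofReal_inv]
        field_simp
      rw [e, norm_mul, Complex.norm_real, Real.norm_of_nonneg h0, mul_comm]
      gcongr
  rw [norm_smul, Complex.norm_real, norm_pow, norm_norm] at h
  exact h

lemma wd_bound {d : ℕ} (f : 𝓢(Ed d, ℂ)) (k l : ℕ) : ∃ C, 0 ≤ C ∧ ∀ x,
    ∀ y, ‖y‖ ^ k * ‖iteratedFDeriv ℝ l (reflectTranslate x f) y‖ ≤ C * (1 + ‖x‖) ^ k := by
  set h := reflectTranslate 0 f
  refine ⟨2 ^ k * (Finset.Iic (k, l)).sup (fun m => SchwartzMap.seminorm ℂ m.1 m.2) h, ?_, ?_⟩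
  · positivity
  intro x
  intro y
  have h1 := SchwartzMap.one_add_le_sup_seminorm_apply (𝕜 := ℂ) (m := (k, l)) le_rfl le_rfl h (y - x)
  rw [iteratedFDeriv_reflectTranslate]
  have h2 : ‖y‖ ^ k ≤ (1 + ‖y - x‖) ^ k * (1 + ‖x‖) ^ k := by
    rw [← mul_pow]
    apply pow_le_pow_left₀ (norm_nonneg _)
    have : ‖y‖ ≤ ‖y - x‖ + ‖x‖ := by simpa using norm_add_le (y - x) x
    nlinarith [norm_nonneg (y-x), norm_nonneg x]
  calc _ ≤ (1 + ‖y - x‖) ^ k * (1 + ‖x‖) ^ k * ‖iteratedFDeriv ℝ l (⇑h) (y - x)‖ := by gcongr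
    _ = ((1 + ‖y - x‖) ^ k  * ‖iteratedFDeriv ℝ l (⇑h) (y - x)‖) * (1 + ‖x‖) ^ k  := by ring
    _ ≤ _ := by gcongr

lemma wd_lip {d : ℕ} (f : 𝓢(Ed d, ℂ)) (k l : ℕ) : ∃ C, 0 ≤ C ∧ ∀ x x' : Ed d, ‖x' - x‖ ≤ 1 →
    ∀ y, ‖y‖ ^ k * ‖iteratedFDeriv ℝ l (reflectTranslate x' f) y -
      iteratedFDeriv ℝ l (reflectTranslate x f) y‖
      ≤ C * (2 + ‖x‖) ^ k * ‖x' - x‖ := by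
  set h := reflectTranslate 0 f
  refine ⟨2 ^ k * (Finset.Iic (k, l+1)).sup (fun m => SchwartzMap.seminorm ℂ m.1 m.2) h, ?_, ?_⟩
  · positivity
  set C := (2 ^ k * (Finset.Iic (k, l+1)).sup (fun m => SchwartzMap.seminorm ℂ m.1 m.2) h) with hC
  have hC0 : 0 ≤ C := by positivity
  intro x x' hxx
  intro y
  rw [iteratedFDeriv_reflectTranslate f x, iteratedFDeriv_reflectTranslate f x']
  by_cases hy : ‖y‖ = 0
  · have hy0 : y = 0 := by simpa using hy
    subst hy0
    rcases Nat.eq_zero_or_pos k with hk | hk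
    · subst hk
      have key := Convex.norm_image_sub_le_of_norm_fderiv_le (𝕜 := ℝ)
        (f := iteratedFDeriv ℝ l (⇑h)) (s := univ) (C := C) (x := 0 - x) (y := 0 - x')
        (fun z _ => ((h.smooth (l+1)).differentiable_iteratedFDeriv
          (by exact_mod_cast Nat.lt_succ_self l)).differentiableAt)
        (fun z _ => by
          rw [norm_fderiv_iteratedFDeriv]
          have h1 := SchwartzMap.one_add_le_sup_seminorm_apply (𝕜 := ℂ) (m := (0, l+1))
            le_rfl le_rfl h z
          simpa [hC] using h1) convex_univ (mem_univ _) (mem_univ _)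
      have e : ‖(0 - x') - (0 - x)‖ = ‖x' - x‖ := by
        rw [← norm_neg]; congr 1; abel
      rw [e] at key
      simpa using key
    · simp [hk.ne']; positivity
  · have hy' : 0 < ‖y‖ ^ k := pow_pos (lt_of_le_of_ne (norm_nonneg _) (Ne.symm hy)) _
    have key := Convex.norm_image_sub_le_of_norm_fderiv_le (𝕜 := ℝ)
        (f := iteratedFDeriv ℝ l (⇑h)) (s := segment ℝ (y - x) (y - x'))
        (C := C * (2 + ‖x‖) ^ k / ‖y‖ ^ k) (x := y - x) (y := y - x')
        (fun z _ => ((h.smooth (l+1)).differentiable_iteratedFDeriv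
          (by exact_mod_cast Nat.lt_succ_self l)).differentiableAt)
        (fun z hz => by
          rw [norm_fderiv_iteratedFDeriv]
          have h1 := SchwartzMap.one_add_le_sup_seminorm_apply (𝕜 := ℂ) (m := (k, l+1))
            le_rfl le_rfl h z
          have hz1 : ‖z - (y - x)‖ ≤ 1 := by
            have hb : segment ℝ (y - x) (y - x') ⊆ Metric.closedBall (y - x) 1 := by
              apply (convex_closedBall _ _).segment_subset
              · simp
              · rw [Metric.mem_closedBall, dist_eq_norm]
                have e : ‖(y - x') - (y - x)‖ = ‖x' - x‖ := by
                  rw [← norm_neg]; congr 1; abel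
                rw [e]; exact hxx
            have := hb hz
            rwa [Metric.mem_closedBall, dist_eq_norm] at this
          have h3 : ‖y‖ ≤ (1 + ‖z‖) * (2 + ‖x‖) := by
            have : ‖y‖ ≤ ‖z‖ + ‖z - (y - x)‖ + ‖x‖ := by
              calc ‖y‖ = ‖z - (z - (y - x)) + x‖ := by congr 1; abel
                _ ≤ ‖z - (z - (y-x))‖ + ‖x‖ := norm_add_le _ _
                _ ≤ _ := by gcongr; exact norm_sub_le _ _
            nlinarith [norm_nonneg z, norm_nonneg x]
          have h2 : ‖y‖ ^ k ≤ (1 + ‖z‖) ^ k * (2 + ‖x‖) ^ k := by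
            rw [← mul_pow]
            exact pow_le_pow_left₀ (norm_nonneg _) h3 _
          rw [le_div_iff₀ hy']
          calc _ ≤ ‖iteratedFDeriv ℝ (l+1) (⇑h) z‖ * ((1 + ‖z‖) ^ k * (2 + ‖x‖) ^ k) := by gcongr
            _ = ((1 + ‖z‖) ^ k * ‖iteratedFDeriv ℝ (l+1) (⇑h) z‖) * (2 + ‖x‖) ^ k := by ring
            _ ≤ _ := by gcongr)
        (convex_segment _ _) (left_mem_segment _ _ _) (right_mem_segment _ _ _)
    have e : ‖(y - x') - (y - x)‖ = ‖x' - x‖ := by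
        rw [← norm_neg]; congr 1; abel
    rw [e] at key
    calc _ ≤ ‖y‖ ^ k * (C * (2 + ‖x‖) ^ k / ‖y‖ ^ k * ‖x' - x‖) := by gcongr
      _ = _ := by field_simp

lemma Wd_continuous {d : ℕ} (s : Finset (ℕ × ℕ)) (f : 𝓢(Ed d, ℂ)) :
    Continuous fun x => Wd s (reflectTranslate x f) := by
  rw [continuous_iff_continuousAt]
  intro x
  have hb := fun i : s => wd_lip f i.1.1 i.1.2
  choose C hC h using hb
  unfold ContinuousAt
  rw [tendsto_iff_norm_sub_tendsto_zero]
  have hlim : Tendsto (fun x' : Ed d => ∑ i : s, C i * (2 + ‖x‖) ^ i.1.1 * ‖x' - x‖) (𝓝 x) (𝓝 0) := by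
    have : Continuous (fun x' : Ed d => ∑ i : s, C i * (2 + ‖x‖) ^ i.1.1 * ‖x' - x‖) := by fun_prop
    simpa using this.tendsto x
  apply squeeze_zero' (Eventually.of_forall fun _ => norm_nonneg _) _ hlim
  filter_upwards [Metric.closedBall_mem_nhds x one_pos] with x' hx'
  have hnn : ∀ i : s, 0 ≤ C i * (2 + ‖x‖) ^ i.1.1 * ‖x' - x‖ := fun i =>
    mul_nonneg (mul_nonneg (hC i) (by positivity)) (norm_nonneg _)
  apply lp.norm_le_of_forall_le (Finset.sum_nonneg fun i _ => hnn i)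
  intro j
  refine (wdv_sub (reflectTranslate x' f) (reflectTranslate x f) j).trans ?_
  refine (h j.1 x x' (by rwa [Metric.mem_closedBall, dist_eq_norm] at hx') j.2.1).trans ?_
  exact Finset.single_le_sum (fun j _ => hnn j) (Finset.mem_univ j.1)

lemma K_factor {d : ℕ} (K : 𝓢(Ed d, ℂ) →L[ℂ] ℂ) : ∃ (s : Finset (ℕ × ℕ))
    (L : Bn d s →L[ℂ] ℂ),
    (∀ φ, K φ = L (Wd s φ)) ∧ ∀ φ, Wd (d := d) s φ = 0 → φ = 0 := by
  have hc : Continuous ((normSeminorm ℂ ℂ).comp K.toLinearMap) := by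
    change Continuous fun φ => ‖K φ‖
    exact K.continuous.norm
  obtain ⟨s0, C, hC0, hC⟩ := Seminorm.bound_of_continuous (schwartz_withSeminorms ℂ (Ed d) ℂ) _ hc
  set s := insert (0, 0) s0
  have hinj : ∀ φ, Wd (d := d) s φ = 0 → φ = 0 := by
    intro φ h
    have h1 := Wd_norm s φ ⟨(0, 0), by simp [s]⟩
    rw [h, norm_zero] at h1
    ext y
    have h2 := (SchwartzMap.norm_le_seminorm ℂ φ y).trans h1
    simpa using h2
  have hinj' : Function.Injective (Wd (d := d) s) := by
    rw [injective_iff_map_eq_zero]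
    exact hinj
  let e := LinearEquiv.ofInjective (Wd (d := d) s) hinj'
  have hb : ∀ φ, ‖K φ‖ ≤ C * ‖Wd s φ‖ := by
    intro φ
    have h1 : ‖K φ‖ ≤ C * (s0.sup (schwartzSeminormFamily ℂ (Ed d) ℂ)) φ := hC φ
    refine h1.trans ?_
    gcongr
    apply Seminorm.finset_sup_apply_le (norm_nonneg _)
    intro i hi
    exact Wd_norm s φ ⟨i, by simp [s, hi]⟩
  let L0 : (LinearMap.range (Wd (d := d) s)) →L[ℂ] ℂ :=
    LinearMap.mkContinuous (K.toLinearMap ∘ₗ e.symm.toLinearMap) C (by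
      intro v
      obtain ⟨φ, rfl⟩ := e.surjective v
      simpa [e] using hb φ)
  obtain ⟨L, hL, -⟩ := exists_extension_norm_eq (LinearMap.range (Wd (d := d) s)) L0
  refine ⟨s, L, fun φ => ?_, hinj⟩
  have := hL (e φ)
  simp [L0] at this
  rw [← this]; rfl

lemma TK_continuous {d : ℕ} (K : 𝓢(Ed d, ℂ) →L[ℂ] ℂ) (f : 𝓢(Ed d, ℂ)) : Continuous (TK K f) := by
  obtain ⟨s, L, hL, -⟩ := K_factor K
  have : TK K f = fun x => L (Wd s (reflectTranslate x f)) := by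
    funext x; exact hL _
  rw [this]
  exact L.continuous.comp (Wd_continuous s f)

lemma Wd_integrable {d : ℕ} (s : Finset (ℕ × ℕ)) (f g : 𝓢(Ed d, ℂ)) :
    Integrable fun x => g x • Wd s (reflectTranslate x f) := by
  have hm : AEStronglyMeasurable (fun x => g x • Wd s (reflectTranslate x f)) volume :=
    (g.continuous.smul (Wd_continuous s f)).aestronglyMeasurable
  have hb : ∀ i : s, ∃ C, 0 ≤ C ∧ ∀ x,
    ∀ y, ‖y‖ ^ i.1.1 * ‖iteratedFDeriv ℝ i.1.2 (reflectTranslate x f) y‖ ≤ C * (1 + ‖x‖) ^ i.1.1 := fun i => wd_bound f _ _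
  choose C hC0 hC using hb
  have hIntg : Integrable (fun x => ∑ i : s, C i * (2 ^ i.1.1 * (‖g x‖ + ‖x‖ ^ i.1.1 * ‖g x‖)))
      volume := by
    apply integrable_finset_sum
    intro i _
    apply Integrable.const_mul
    apply Integrable.const_mul
    exact g.integrable.norm.add (g.integrable_pow_mul volume i.1.1)
  refine hIntg.mono' hm (Eventually.of_forall fun x => ?_)
  have hnn : ∀ i : s, 0 ≤ C i * (2 ^ i.1.1 * (‖g x‖ + ‖x‖ ^ i.1.1 * ‖g x‖)) := fun i =>
    mul_nonneg (hC0 i) (by positivity)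
  rw [norm_smul]
  rcases eq_or_ne (g x) 0 with hg | hg
  · rw [hg]; simp
  have hg' : 0 < ‖g x‖ := norm_pos_iff.2 hg
  rw [← le_div_iff₀' hg']
  apply lp.norm_le_of_forall_le (div_nonneg (Finset.sum_nonneg fun i _ => hnn i) hg'.le)
  intro j
  obtain ⟨i, y, m⟩ := j
  rw [le_div_iff₀' hg']
  refine le_trans ?_ (Finset.single_le_sum (fun j _ => hnn j) (Finset.mem_univ i))
  have h1 := (wdv_le (s := s) (reflectTranslate x f) ⟨i, y, m⟩).trans (hC i x y)
  rw [Wd_apply]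
  have h2 : (1 + ‖x‖) ^ i.1.1 ≤ 2 ^ i.1.1 * (1 + ‖x‖ ^ i.1.1) := by
    rcases le_total ‖x‖ 1 with hx | hx
    · have : (1 + ‖x‖) ^ i.1.1 ≤ 2 ^ i.1.1 := pow_le_pow_left₀ (by positivity) (by linarith) _
      have h3 : 0 ≤ ‖x‖ ^ i.1.1 := by positivity
      have h4 : (0:ℝ) < 2 ^ i.1.1 := by positivity
      nlinarith
    · have : (1 + ‖x‖) ^ i.1.1 ≤ (2 * ‖x‖) ^ i.1.1 := pow_le_pow_left₀ (by positivity) (by linarith) _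
      rw [mul_pow] at this
      have h4 : (0:ℝ) < 2 ^ i.1.1 := by positivity
      nlinarith
  calc _ ≤ ‖g x‖ * (C i * (1 + ‖x‖) ^ i.1.1) := by gcongr
    _ ≤ ‖g x‖ * (C i * (2 ^ i.1.1 * (1 + ‖x‖ ^ i.1.1))) := by
      gcongr; exact hC0 i
    _ = _ := by ring

lemma TK_swap {d : ℕ} (K : 𝓢(Ed d, ℂ) →L[ℂ] ℂ) (f g : 𝓢(Ed d, ℂ)) :
    ∫ x, TK K f x * g x =
      K (SchwartzMap.convolution (ContinuousLinearMap.mul ℂ ℂ) g (reflectTranslate 0 f)) := by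
  obtain ⟨s, L, hL, -⟩ := K_factor K
  have hI := Wd_integrable s f g
  have h1 : ∫ x, TK K f x * g x = L (∫ x, g x • Wd s (reflectTranslate x f)) := by
    rw [← ContinuousLinearMap.integral_comp_comm L hI]
    congr 1; funext x
    rw [map_smul, ← hL, smul_eq_mul, mul_comm]; rfl
  rw [h1, hL]
  congr 1
  ext j
  obtain ⟨i, y, m⟩ := j
  let ev : Bn d s →L[ℂ] ℂ := LinearMap.mkContinuous
    { toFun := fun v => (v : ∀ _, ℂ) ⟨i, y, m⟩
      map_add' := fun _ _ => rfl
      map_smul' := fun _ _ => rfl } 1 (fun v => by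
        rw [one_mul]; exact lp.norm_apply_le_norm (by simp) v _)
  have hev : ∀ v : Bn d s, ev v = (v : ∀ _, ℂ) ⟨i, y, m⟩ := fun v => rfl
  rw [← hev, ← hev, ← ContinuousLinearMap.integral_comp_comm ev hI]
  have hW : ∀ φ, ev (Wd s φ) = ((‖y‖ ^ i.1.1 * (∏ r, ‖m r‖)⁻¹ : ℝ) : ℂ) * (∂^{m} φ) y := by
    intro φ
    rw [SchwartzMap.iteratedLineDerivOp_eq_iteratedFDeriv]; rfl
  rw [hW, iteratedLineDeriv_conv, SchwartzMap.convolution_apply, MeasureTheory.convolution,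
    ← integral_const_mul]
  congr 1; funext x
  rw [map_smul, smul_eq_mul]
  have h3 : ev (Wd s (reflectTranslate x f)) =
    ((‖y‖ ^ i.1.1 * (∏ r, ‖m r‖)⁻¹ : ℝ) : ℂ) * (∂^{m} (reflectTranslate 0 f)) (y - x) := by
    rw [SchwartzMap.iteratedLineDerivOp_eq_iteratedFDeriv, ← iteratedFDeriv_reflectTranslate]
    rfl
  rw [h3]
  simp only [ContinuousLinearMap.mul_apply']
  ring

lemma K_reproduce {d : ℕ} (K : 𝓢(Ed d, ℂ) →L[ℂ] ℂ)
    (hKhat : ∃ R : ℝ, 0 < R ∧ ∀ g : 𝓢(Ed d, ℂ),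
      (∀ ξ ∈ Metric.closedBall (0 : Ed d) R, g ξ = 0) →
      K (SchwartzMap.fourierTransformCLM ℂ g) = 0) :
    ∃ η : 𝓢(Ed d, ℂ), ∀ φ, K φ =
      K (SchwartzMap.convolution (ContinuousLinearMap.mul ℂ ℂ) η φ) := by
  obtain ⟨R, hR, hK⟩ := hKhat
  let b : ContDiffBump (0 : Ed d) := ⟨R, R + 1, hR, by linarith⟩
  have hb1 : HasCompactSupport (fun x => ((b x : ℝ) : ℂ)) :=
    b.hasCompactSupport.comp_left (g := fun r : ℝ => (r : ℂ)) (by simp)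
  have hb2 : ContDiff ℝ ((⊤ : ℕ∞) : WithTop ℕ∞) (fun x => ((b x : ℝ) : ℂ)) :=
    Complex.ofRealCLM.contDiff.comp b.contDiff
  let χ : 𝓢(Ed d, ℂ) := hb1.toSchwartzMap hb2
  have hχ : ∀ x, χ x = ((b x : ℝ) : ℂ) := fun x => rfl
  let χr := reflectTranslate 0 χ
  have hχr : ∀ x ∈ Metric.closedBall (0 : Ed d) R, χr x = 1 := by
    intro x hx
    change χ (0 - x) = 1
    rw [hχ, b.one_of_mem_closedBall (by simpa using hx)]; simp
  refine ⟨𝓕⁻ χ, fun φ => ?_⟩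
  have h0 := hK (𝓕⁻ φ - SchwartzMap.pairing (ContinuousLinearMap.mul ℂ ℂ) χr (𝓕⁻ φ)) (by
    intro ξ hξ
    simp [hχr ξ hξ])
  have h1 : SchwartzMap.fourierTransformCLM ℂ
      (𝓕⁻ φ - SchwartzMap.pairing (ContinuousLinearMap.mul ℂ ℂ) χr (𝓕⁻ φ)) =
      φ - 𝓕 (SchwartzMap.pairing (ContinuousLinearMap.mul ℂ ℂ) χr (𝓕⁻ φ)) := by
    rw [map_sub]
    change 𝓕 (𝓕⁻ φ) - _ = _
    rw [FourierTransform.fourier_fourierInv_eq]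
    rfl
  rw [h1, map_sub, sub_eq_zero] at h0
  rw [h0]
  congr 1
  rw [← FourierTransform.fourierInv_fourier_eq (F := 𝓢(Ed d, ℂ))
    (SchwartzMap.convolution (ContinuousLinearMap.mul ℂ ℂ) (𝓕⁻ χ) φ),
    SchwartzMap.fourier_convolution, FourierTransform.fourier_fourierInv_eq]
  ext x
  rw [SchwartzMap.fourierInv_coe, SchwartzMap.fourier_coe, Real.fourierInv_eq_fourier_comp_neg]
  refine congrArg (fun h : Ed d → ℂ => 𝓕 h x) ?_
  ext ξ
  simp [SchwartzMap.fourierInv_coe, SchwartzMap.fourier_coe, Real.fourierInv_eq_fourier_neg]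
  left
  change χ (0 - ξ) = _
  simp
end Swap

section LorentzBasics
variable {α : Type*} [MeasurableSpace α] {μ : Measure α}

lemma distribFn_antitone (f : α → ℂ) : Antitone (distribFn μ f) := fun _ _ h =>
  measure_mono fun _ hx => lt_of_le_of_lt h hx

lemma le_rearr {f : α → ℂ} {s : ℝ≥0∞} {t : ℝ} (h : ENNReal.ofReal t < distribFn μ f s) :
    s ≤ rearrangement μ f t := by
  apply le_sInf
  intro s' hs'
  by_contra hlt
  push Not at hlt
  exact absurd (lt_of_lt_of_le h (distribFn_antitone f hlt.le)) (not_lt.2 hs')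

lemma lt_distrib {f : α → ℂ} {s : ℝ≥0∞} {t : ℝ} (h : s < rearrangement μ f t) :
    ENNReal.ofReal t < distribFn μ f s := by
  by_contra hh
  push Not at hh
  exact absurd (sInf_le (show s ∈ {s : ℝ≥0∞ | distribFn μ f s ≤ ENNReal.ofReal t} from hh))
    (not_le.2 h)

lemma rearr_le {f : α → ℂ} {s : ℝ≥0∞} {t : ℝ} (h : distribFn μ f s ≤ ENNReal.ofReal t) :
    rearrangement μ f t ≤ s := sInf_le h

lemma rearr_antitone (f : α → ℂ) : Antitone (rearrangement μ f) := fun _ _ h =>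
  sInf_le_sInf fun _ hs => le_trans hs (ENNReal.ofReal_le_ofReal h)

lemma rearr_mono_distrib {β : Type*} [MeasurableSpace β] {ν : Measure β} {f : α → ℂ} {g : β → ℂ}
    (h : ∀ s, distribFn μ f s ≤ distribFn ν g s) (t : ℝ) :
    rearrangement μ f t ≤ rearrangement ν g t :=
  sInf_le_sInf fun s hs => le_trans (h s) hs

lemma lorentz_mono_rearr {β : Type*} [MeasurableSpace β] {ν : Measure β} (p q : ℝ≥0∞)
    {f : α → ℂ} {g : β → ℂ}
    (h : ∀ t, 0 < t → rearrangement μ f t ≤ rearrangement ν g t) :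
    lorentzNorm μ p q f ≤ lorentzNorm ν p q g := by
  unfold lorentzNorm
  split_ifs
  · gcongr with t
    exact h _ t.2
  · gcongr ?_ ^ _
    refine setLIntegral_mono' measurableSet_Ioi fun t ht => ?_
    gcongr
    exact h _ ht

lemma lorentz_mono (p q : ℝ≥0∞) {f g : α → ℂ} (h : ∀ x, ‖f x‖ ≤ ‖g x‖) :
    lorentzNorm μ p q f ≤ lorentzNorm μ p q g := by
  refine lorentz_mono_rearr p q fun t _ => rearr_mono_distrib (fun s => measure_mono fun x hx => ?_) t
  have hx' : s < (‖f x‖₊ : ℝ≥0∞) := hx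
  exact lt_of_lt_of_le hx' (ENNReal.coe_le_coe.2 (h x))

lemma lorentz_comp_mp (p q : ℝ≥0∞) {f : α → ℂ} (hf : Measurable f) {T : α → α}
    (hT : MeasurePreserving T μ μ) :
    lorentzNorm μ p q (fun x => f (T x)) = lorentzNorm μ p q f := by
  have : ∀ s, distribFn μ (fun x => f (T x)) s = distribFn μ f s := fun s => by
    unfold distribFn
    have hm : MeasurableSet {x | s < (‖f x‖₊ : ℝ≥0∞)} :=
      measurableSet_lt measurable_const hf.nnnorm.coe_nnreal_ennreal
    exact hT.measure_preimage hm.nullMeasurableSet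
  apply le_antisymm
  · exact lorentz_mono_rearr p q fun t _ => rearr_mono_distrib (fun s => (this s).le) t
  · exact lorentz_mono_rearr p q fun t _ => rearr_mono_distrib (fun s => (this s).ge) t

lemma rearr_measurable (f : α → ℂ) : Measurable (rearrangement μ f) :=
  (rearr_antitone f).measurable

lemma tonelli3 {β : Type*} [MeasurableSpace β] {ν : Measure β} [SFinite ν] {ρ : Measure ℝ}
    [SFinite ρ] {A B : β → ℝ → ℝ≥0∞}
    (hA : Measurable (Function.uncurry A)) (hB : Measurable (Function.uncurry B)) :
    ∫⁻ x, (∫⁻ s, A x s ∂ρ) * (∫⁻ u, B x u ∂ρ) ∂ν =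
      ∫⁻ s, ∫⁻ u, ∫⁻ x, A x s * B x u ∂ν ∂ρ ∂ρ := by
  have hA1 : ∀ x, Measurable (A x) := fun x => hA.comp measurable_prodMk_left
  have hB1 : ∀ x, Measurable (B x) := fun x => hB.comp measurable_prodMk_left
  calc _ = ∫⁻ x, ∫⁻ s, A x s * (∫⁻ u, B x u ∂ρ) ∂ρ ∂ν := by
        congr 1; ext x; rw [lintegral_mul_const _ (hA1 x)]
    _ = ∫⁻ s, ∫⁻ x, A x s * (∫⁻ u, B x u ∂ρ) ∂ν ∂ρ := by
        apply lintegral_lintegral_swap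
        exact (hA.mul ((hB.lintegral_prod_right').comp measurable_fst)).aemeasurable
    _ = ∫⁻ s, ∫⁻ x, ∫⁻ u, A x s * B x u ∂ρ ∂ν ∂ρ := by
        congr 1; ext s; congr 1; ext x; rw [lintegral_const_mul _ (hB1 x)]
    _ = _ := by
        congr 1; ext s
        apply lintegral_lintegral_swap
        have : Measurable fun x => A x s := hA.comp measurable_prodMk_right
        exact ((this.comp measurable_fst).mul hB).aemeasurable

lemma lint_lt (r : ℝ≥0∞) :
    ∫⁻ s in Ioi (0:ℝ), (if ENNReal.ofReal s < r then (1:ℝ≥0∞) else 0) = r := by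
  have hm : MeasurableSet {s : ℝ | ENNReal.ofReal s < r} :=
    measurableSet_lt ENNReal.measurable_ofReal measurable_const
  have : (fun s : ℝ => if ENNReal.ofReal s < r then (1:ℝ≥0∞) else 0) =
      {s : ℝ | ENNReal.ofReal s < r}.indicator 1 := by
    ext s; simp [Set.indicator]
  rw [this, lintegral_indicator_one hm, Measure.restrict_apply hm]
  induction r using ENNReal.recTopCoe with
  | top => simp
  | coe r =>
    have : {s : ℝ | ENNReal.ofReal s < r} ∩ Ioi 0 = Ioo 0 (r:ℝ) := by
      ext s
      simp only [mem_inter_iff, mem_setOf_eq, mem_Ioi, mem_Ioo]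
      constructor
      · rintro ⟨h, h0⟩
        refine ⟨h0, ?_⟩
        have := (ENNReal.ofReal_lt_coe_iff h0.le).1 h
        exact this
      · rintro ⟨h0, h⟩
        exact ⟨(ENNReal.ofReal_lt_coe_iff h0.le).2 h, h0⟩
    rw [this]; simp

lemma hardy_littlewood [SFinite μ] {k h : α → ℂ} (hk : Measurable k) (hh : Measurable h) :
    ∫⁻ x, ‖k x‖ₑ * ‖h x‖ₑ ∂μ ≤
      ∫⁻ t in Ioi (0:ℝ), rearrangement μ k t * rearrangement μ h t := by
  let ρ : Measure ℝ := volume.restrict (Ioi 0)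
  let A : (α → ℂ) → α → ℝ → ℝ≥0∞ := fun k x s => if ENNReal.ofReal s < ‖k x‖ₑ then 1 else 0
  let A' : (α → ℂ) → ℝ → ℝ → ℝ≥0∞ := fun k t s =>
    if ENNReal.ofReal t < distribFn μ k (ENNReal.ofReal s) then 1 else 0
  have hA : ∀ {k}, Measurable k → Measurable (Function.uncurry (A k)) := by
    intro k hk
    refine Measurable.ite (measurableSet_lt ?_ ?_) measurable_const measurable_const
    · exact ENNReal.measurable_ofReal.comp measurable_snd
    · exact (hk.comp measurable_fst).enorm
  have hA' : ∀ {k}, Measurable (Function.uncurry (A' k)) := by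
    intro k
    refine Measurable.ite (measurableSet_lt ?_ ?_) measurable_const measurable_const
    · exact ENNReal.measurable_ofReal.comp measurable_fst
    · have : Antitone fun s : ℝ => distribFn μ k (ENNReal.ofReal s) := fun a b hab =>
        distribFn_antitone k (ENNReal.ofReal_le_ofReal hab)
      exact this.measurable.comp measurable_snd
  have e1 : ∀ {k : α → ℂ} x, ∫⁻ s, A k x s ∂ρ = ‖k x‖ₑ := fun x => lint_lt _
  have e2 : ∀ {k} t, ∫⁻ s, A' k t s ∂ρ ≤ rearrangement μ k t := by
    intro k t
    rw [← lint_lt (rearrangement μ k t)]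
    have : ∀ᵐ s ∂ρ, s ≠ (rearrangement μ k t).toReal := by
      apply ae_restrict_of_ae
      simp [ae_iff]
    have h0 : ∀ᵐ s ∂ρ, s ∈ Ioi (0:ℝ) := ae_restrict_mem measurableSet_Ioi
    refine lintegral_mono_ae ?_
    filter_upwards [this, h0] with s hs hs0
    simp only [A']
    split_ifs with h1 h2
    · exact le_rfl
    · exfalso
      have h3 := le_rearr h1
      have h4 := le_antisymm h3 (not_lt.1 h2)
      apply hs
      rw [← h4, ENNReal.toReal_ofReal (le_of_lt hs0)]
    · exact zero_le
    · exact zero_le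
  calc ∫⁻ x, ‖k x‖ₑ * ‖h x‖ₑ ∂μ = ∫⁻ x, (∫⁻ s, A k x s ∂ρ) * (∫⁻ u, A h x u ∂ρ) ∂μ := by
        simp only [e1]
    _ = ∫⁻ s, ∫⁻ u, ∫⁻ x, A k x s * A h x u ∂μ ∂ρ ∂ρ := tonelli3 (hA hk) (hA hh)
    _ ≤ ∫⁻ s, ∫⁻ u, ∫⁻ t, A' k t s * A' h t u ∂ρ ∂ρ ∂ρ := by
        refine lintegral_mono fun s => lintegral_mono fun u => ?_
        have l1 : ∫⁻ x, A k x s * A h x u ∂μ ≤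
            min (distribFn μ k (ENNReal.ofReal s)) (distribFn μ h (ENNReal.ofReal u)) := by
          have hmA : ∀ {k : α → ℂ} (hk : Measurable k) (s : ℝ), ∫⁻ x, A k x s ∂μ =
              distribFn μ k (ENNReal.ofReal s) := by
            intro k hk s
            have hm : MeasurableSet {x | ENNReal.ofReal s < ‖k x‖ₑ} :=
              measurableSet_lt measurable_const hk.enorm
            have : (fun x => A k x s) = {x | ENNReal.ofReal s < ‖k x‖ₑ}.indicator 1 := by
              ext x; simp [A, Set.indicator]
            rw [this, lintegral_indicator_one hm]; rfl
          apply le_min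
          · rw [← hmA hk]
            refine lintegral_mono fun x => ?_
            simp only [A]; split_ifs <;> simp
          · rw [← hmA hh]
            refine lintegral_mono fun x => ?_
            simp only [A]; split_ifs <;> simp
        refine l1.trans ?_
        conv_lhs => rw [← lint_lt (min (distribFn μ k (ENNReal.ofReal s)) (distribFn μ h (ENNReal.ofReal u)))]
        refine lintegral_mono fun t => ?_
        simp only [A', lt_min_iff]
        split_ifs <;> simp_all
    _ = ∫⁻ t, (∫⁻ s, A' k t s ∂ρ) * (∫⁻ u, A' h t u ∂ρ) ∂ρ := (tonelli3 hA' hA').symm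
    _ ≤ _ := lintegral_mono fun t => mul_le_mul' (e2 t) (e2 t)

lemma conj_toReal {p : ℝ} (hp : 1 ≤ p) {p' : ℝ≥0∞} (hp' : 1 / ENNReal.ofReal p + 1 / p' = 1) :
    (1/p').toReal + (1 / ENNReal.ofReal p).toReal = 1 := by
  have h2 : 1 / p' ≠ ∞ := by
    intro h; rw [h] at hp'; simp at hp'
  have h1 : 1 / ENNReal.ofReal p ≠ ∞ := by
    intro h; rw [h] at hp'; simp at hp'
  rw [add_comm, ← ENNReal.toReal_add h1 h2, hp']; simp

lemma conj_inf {q : ℝ} (hq : 1 ≤ q) {q' : ℝ≥0∞} (hq' : 1 / ENNReal.ofReal q + 1 / q' = 1) :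
    (q = 1 ∧ q' = ∞) ∨ (1 < q ∧ q' ≠ ∞ ∧ q.HolderConjugate q'.toReal) := by
  have h := conj_toReal hq hq'
  have hq1 : (1 / ENNReal.ofReal q).toReal = 1 / q := by
    rw [ENNReal.toReal_div, ENNReal.toReal_ofReal (by linarith)]; simp
  rw [hq1, ENNReal.toReal_div, ENNReal.toReal_one] at h
  rcases eq_or_lt_of_le hq with h1 | h1
  · left
    subst h1
    refine ⟨rfl, ?_⟩
    by_contra hne
    simp at hq'
    exact hne hq'
  · right
    have : q' ≠ ∞ := by
      rintro rfl
      simp at h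
      linarith
    refine ⟨h1, this, ?_⟩
    rw [Real.holderConjugate_iff]
    refine ⟨h1, ?_⟩
    rw [← h]; simp [add_comm]

lemma holder_lorentz [SFinite μ] {p q : ℝ} (hp : 1 ≤ p) (hq : 1 ≤ q) {p' q' : ℝ≥0∞}
    (hp' : 1 / ENNReal.ofReal p + 1 / p' = 1)
    (hq' : 1 / ENNReal.ofReal q + 1 / q' = 1) {k h : α → ℂ} (hk : Measurable k)
    (hh : Measurable h) :
    ∫⁻ x, ‖k x‖ₑ * ‖h x‖ₑ ∂μ ≤
      lorentzNorm μ p' q' k * lorentzNorm μ (ENNReal.ofReal p) (ENNReal.ofReal q) h := by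
  refine (hardy_littlewood hk hh).trans ?_
  have hab := conj_toReal hp hp'
  set a := (1/p').toReal
  set b := (1 / ENNReal.ofReal p).toReal
  set F : ℝ → ℝ≥0∞ := fun t => ENNReal.ofReal (t ^ a) * rearrangement μ k t with hF
  set G : ℝ → ℝ≥0∞ := fun t => ENNReal.ofReal (t ^ b) * rearrangement μ h t with hG
  have hFm : Measurable F := by
    refine Measurable.mul ?_ (rearr_measurable k)
    exact ENNReal.measurable_ofReal.comp (measurable_id.pow_const a)
  have hGm : Measurable G := by
    refine Measurable.mul ?_ (rearr_measurable h)
    exact ENNReal.measurable_ofReal.comp (measurable_id.pow_const b)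
  have hwm : Measurable fun t : ℝ => (ENNReal.ofReal t)⁻¹ :=
    ENNReal.measurable_ofReal.inv
  let ν : Measure ℝ := (volume.restrict (Ioi (0:ℝ))).withDensity fun t => (ENNReal.ofReal t)⁻¹
  have hν : ∀ H : ℝ → ℝ≥0∞, Measurable H →
      ∫⁻ t, H t ∂ν = ∫⁻ t in Ioi (0:ℝ), H t / ENNReal.ofReal t := by
    intro H hH
    rw [lintegral_withDensity_eq_lintegral_mul _ hwm hH]
    congr 1; ext t; simp [div_eq_mul_inv, mul_comm]
  have e0 : ∫⁻ t in Ioi (0:ℝ), rearrangement μ k t * rearrangement μ h t = ∫⁻ t, F t * G t ∂ν := by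
    rw [hν (fun t => F t * G t) (hFm.mul hGm)]
    refine setLIntegral_congr_fun measurableSet_Ioi fun t ht => ?_
    have ht : 0 < t := ht
    have : ENNReal.ofReal t = ENNReal.ofReal (t ^ a) * ENNReal.ofReal (t ^ b) := by
      rw [← ENNReal.ofReal_mul (by positivity), ← Real.rpow_add ht, hab, Real.rpow_one]
    simp only [hF, hG]
    rw [mul_mul_mul_comm, ← this, mul_comm (ENNReal.ofReal t), ENNReal.mul_div_cancel_right] <;> simp [ht]
  rw [e0]
  have hqr : (ENNReal.ofReal q).toReal = q := ENNReal.toReal_ofReal (by linarith)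
  rcases conj_inf hq hq' with ⟨rfl, rfl⟩ | ⟨h1, h2, h3⟩
  · have hR : lorentzNorm μ (ENNReal.ofReal p) (ENNReal.ofReal 1) h = ∫⁻ t, G t ∂ν := by
      rw [hν _ hGm]; simp [lorentzNorm, hG, b]
    rw [hR, ← lintegral_const_mul _ hGm]
    have : ∀ᵐ t ∂ν, t ∈ Ioi (0:ℝ) :=
      (withDensity_absolutelyContinuous _ _).ae_le (ae_restrict_mem measurableSet_Ioi)
    refine lintegral_mono_ae ?_
    filter_upwards [this] with t ht
    gcongr
    simp only [lorentzNorm, if_true]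
    exact le_iSup (fun t : Ioi (0:ℝ) => ENNReal.ofReal ((t:ℝ) ^ (1/p').toReal) * rearrangement μ k t) ⟨t, ht⟩
  · have := ENNReal.lintegral_mul_le_Lp_mul_Lq ν h3.symm hFm.aemeasurable hGm.aemeasurable
    simp only [Pi.mul_apply] at this
    refine this.trans (le_of_eq ?_)
    rw [hν _ (hFm.pow_const _), hν _ (hGm.pow_const _)]
    simp only [lorentzNorm, if_neg h2, if_neg ENNReal.ofReal_ne_top, hqr]
    rfl

end LorentzBasics

section SchwartzLorentz

lemma lorentz_finite_of_decay {α : Type*} [MeasurableSpace α] {μ : Measure α} {p q : ℝ}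
    (hp : 1 ≤ p) (hq : 1 ≤ q) {f : α → ℂ} {M : ℝ} (hM : 0 ≤ M)
    (h1 : ∀ t, 0 < t → rearrangement μ f t ≤ ENNReal.ofReal M)
    (h2 : ∀ t, 0 < t → rearrangement μ f t ≤ ENNReal.ofReal (M / t ^ 2)) :
    lorentzNorm μ (ENNReal.ofReal p) (ENNReal.ofReal q) f < ∞ := by
  have hqr : (ENNReal.ofReal q).toReal = q := ENNReal.toReal_ofReal (by linarith)
  have hpr : (1 / ENNReal.ofReal p).toReal = 1 / p := by
    rw [ENNReal.toReal_div, ENNReal.toReal_ofReal (by linarith)]; simp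
  simp only [lorentzNorm, if_neg ENNReal.ofReal_ne_top, hqr, hpr]
  apply ENNReal.rpow_lt_top_of_nonneg (by positivity)
  rw [← Ioc_union_Ioi_eq_Ioi (zero_le_one' ℝ)]
  refine ((lintegral_union_le _ _ _).trans_lt ?_).ne
  have key : ∀ (t c : ℝ), 0 < t → 0 ≤ c → rearrangement μ f t ≤ ENNReal.ofReal c →
      (ENNReal.ofReal (t ^ (1/p)) * rearrangement μ f t) ^ q / ENNReal.ofReal t ≤
        ENNReal.ofReal ((t ^ (1/p) * c) ^ q / t) := by
    intro t c ht hc h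
    rw [ENNReal.ofReal_div_of_pos ht, ← ENNReal.ofReal_rpow_of_nonneg (x := t ^ (1/p) * c) (by positivity) (by linarith),
      ENNReal.ofReal_mul (by positivity)]
    gcongr
  refine ENNReal.add_lt_top.2 ⟨?_, ?_⟩
  · have hi : IntegrableOn (fun t : ℝ => M ^ q * t ^ (q / p - 1)) (Ioc 0 1) := by
      have := intervalIntegral.intervalIntegrable_rpow' (a := 0) (b := 1) (r := q/p - 1)
        (by have : 0 < q / p := by positivity
            linarith)
      rw [intervalIntegrable_iff_integrableOn_Ioc_of_le zero_le_one] at this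
      exact this.const_mul _
    refine lt_of_le_of_lt ?_ hi.lintegral_lt_top
    refine setLIntegral_mono' measurableSet_Ioc fun t ht => ?_
    refine (key t M ht.1 hM (h1 t ht.1)).trans (le_of_eq ?_)
    congr 1
    have ht0 : 0 < t := ht.1
    rw [Real.mul_rpow (by positivity) hM, ← Real.rpow_mul ht0.le, Real.rpow_sub ht0, Real.rpow_one]
    rw [show 1 / p * q = q / p by ring]; ring
  · have hi : IntegrableOn (fun t : ℝ => M ^ q * t ^ (-2 : ℝ)) (Ioi 1) :=
      (integrableOn_Ioi_rpow_of_lt (by norm_num) one_pos).const_mul _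
    refine lt_of_le_of_lt ?_ hi.lintegral_lt_top
    refine setLIntegral_mono' measurableSet_Ioi fun t ht => ?_
    have ht1 : 1 < t := ht
    have ht0 : 0 < t := by linarith
    refine (key t _ ht0 (by positivity) (h2 t ht0)).trans (ENNReal.ofReal_le_ofReal ?_)
    have e1 : t ^ (1/p) ≤ t := by
      conv_rhs => rw [← Real.rpow_one t]
      apply Real.rpow_le_rpow_of_exponent_le ht1.le
      rw [div_le_one (by linarith)]; exact hp
    have e2 : t ^ (1/p) * (M / t^2) ≤ M / t := by
      calc _ ≤ t * (M / t^2) := by gcongr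
        _ = M / t := by field_simp
    calc (t ^ (1/p) * (M / t^2)) ^ q / t ≤ (M / t) ^ q / t := by gcongr
      _ = M ^ q / (t ^ q * t) := by rw [Real.div_rpow hM ht0.le]; field_simp
      _ ≤ M ^ q / (t * t) := by
          gcongr
          conv_lhs => rw [← Real.rpow_one t]
          exact Real.rpow_le_rpow_of_exponent_le ht1.le hq
      _ = M ^ q * t ^ (-2:ℝ) := by
          rw [Real.rpow_neg ht0.le]; norm_cast
          rw [div_eq_mul_inv, sq]

lemma schwartz_lorentz_lt_top {d : ℕ} {p q : ℝ} (hd : d ≠ 0) (hp : 1 ≤ p) (hq : 1 ≤ q) (f : 𝓢(Ed d, ℂ)) :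
    lorentzNorm volume (ENNReal.ofReal p) (ENNReal.ofReal q) (⇑f) < ∞ := by
  obtain ⟨C0, hC0, h0⟩ := f.decay 0 0
  obtain ⟨C1, hC1, h1⟩ := f.decay (2 * d) 0
  simp only [pow_zero, one_mul, norm_iteratedFDeriv_zero] at h0 h1
  set V : ℝ := (volume (Metric.closedBall (0 : Ed d) 1)).toReal with hV
  have hVt : volume (Metric.closedBall (0 : Ed d) 1) = ENNReal.ofReal V :=
    (ENNReal.ofReal_toReal measure_closedBall_lt_top.ne).symm
  have hV0 : 0 < V := ENNReal.toReal_pos (Metric.measure_closedBall_pos _ _ one_pos).ne'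
    measure_closedBall_lt_top.ne
  set M := max C0 (C1 * V ^ 2)
  have hM : 0 < M := lt_max_of_lt_left hC0
  refine lorentz_finite_of_decay hp hq hM.le (fun t ht => ?_) (fun t ht => ?_)
  · refine (rearr_le (s := ENNReal.ofReal M) ?_)
    have : {x : Ed d | ENNReal.ofReal M < (‖f x‖₊ : ℝ≥0∞)} = ∅ := by
      ext x
      simp only [mem_setOf_eq, mem_empty_iff_false, iff_false, not_lt]
      rw [← enorm_eq_nnnorm, ← ofReal_norm]
      exact ENNReal.ofReal_le_ofReal ((h0 x).trans (le_max_left _ _))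
    simp [distribFn, this]
  · refine (rearr_le (s := ENNReal.ofReal (M / t ^2)) ?_)
    have hdR : (0:ℝ) < d := by positivity
    set r : ℝ := (t / V) ^ ((1:ℝ) / d)
    have hr : 0 ≤ r := by positivity
    have hrd : r ^ d = t / V := by
      rw [← Real.rpow_natCast, ← Real.rpow_mul (by positivity)]
      rw [one_div_mul_cancel hdR.ne', Real.rpow_one]
    have hsub : {x : Ed d | ENNReal.ofReal (M/t^2) < (‖f x‖₊ : ℝ≥0∞)} ⊆ Metric.closedBall 0 r := by
      intro x hx
      simp only [mem_setOf_eq] at hx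
      rw [← enorm_eq_nnnorm, ← ofReal_norm, ENNReal.ofReal_lt_ofReal_iff_of_nonneg (by positivity)] at hx
      rw [mem_closedBall_zero_iff]
      by_contra hlt
      push Not at hlt
      have a1 : t / V < ‖x‖ ^ d := by rw [← hrd]; exact pow_lt_pow_left₀ hlt hr hd
      have a2 : (t/V)^2 < ‖x‖ ^ (2 * d) := by
        rw [mul_comm, pow_mul]; exact pow_lt_pow_left₀ a1 (by positivity) two_ne_zero
      have a3 : (t/V)^2 * (M / t^2) < C1 := by
        refine lt_of_lt_of_le ?_ (h1 x)
        exact mul_lt_mul'' a2 hx (by positivity) (by positivity)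
      have a4 : (t/V)^2 * (M / t^2) = M / V^2 := by field_simp
      rw [a4, div_lt_iff₀ (by positivity)] at a3
      exact absurd (le_max_right C0 (C1 * V^2)) (not_le.2 a3)
    refine (measure_mono hsub).trans (le_of_eq ?_)
    rw [Measure.addHaar_closedBall' _ _ hr, hVt, ← ENNReal.ofReal_mul (by positivity)]
    simp only [finrank_euclideanSpace, Fintype.card_fin, hrd]
    congr 1; field_simp

lemma conv_enorm_le {d : ℕ} {p q : ℝ} (hp : 1 ≤ p) (hq : 1 ≤ q) {p' q' : ℝ≥0∞}
    (hp' : 1 / ENNReal.ofReal p + 1 / p' = 1)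
    (hq' : 1 / ENNReal.ofReal q + 1 / q' = 1) {k h : Ed d → ℂ} (hk : Measurable k)
    (hh : Measurable h) (x : Ed d) :
    ∫⁻ y, ‖k y‖ₑ * ‖h (x - y)‖ₑ ≤
      lorentzNorm volume p' q' k * lorentzNorm volume (ENNReal.ofReal p) (ENNReal.ofReal q) h := by
  have := holder_lorentz (μ := volume) hp hq hp' hq' hk (h := fun y => h (x - y))
    (hh.comp (measurable_const.sub measurable_id))
  rwa [lorentz_comp_mp _ _ hh (Measure.measurePreserving_sub_left volume x)] at this

lemma part_i_rev {d : ℕ} (hd : d ≠ 0) {p q : ℝ} (hp : 1 ≤ p) (hq : 1 ≤ q) {p' q' : ℝ≥0∞}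
    (hp' : 1 / ENNReal.ofReal p + 1 / p' = 1)
    (hq' : 1 / ENNReal.ofReal q + 1 / q' = 1)
    (K : 𝓢(Ed d, ℂ) →L[ℂ] ℂ) {k : Ed d → ℂ} (hk : Measurable k)
    (hkN : lorentzNorm volume p' q' k < ∞)
    (hK : ∀ g : 𝓢(Ed d, ℂ), K g = ∫ x : Ed d, k x * g x) (g : 𝓢(Ed d, ℂ)) :
    ∃ C : ℝ, ∀ f : 𝓢(Ed d, ℂ), ‖∫ x : Ed d, TK K f x * g x‖ ≤
          C * (lorentzNorm volume (ENNReal.ofReal p) (ENNReal.ofReal q) (⇑f)).toReal := by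
  refine ⟨(lorentzNorm volume p' q' k).toReal * ∫ x, ‖g x‖, fun f => ?_⟩
  set A := (lorentzNorm volume p' q' k).toReal
  set B := (lorentzNorm volume (ENNReal.ofReal p) (ENNReal.ofReal q) (⇑f)).toReal
  have hb : ∀ x, ‖TK K f x‖ ≤ A * B := by
    intro x
    have h1 := conv_enorm_le hp hq hp' hq' hk f.continuous.measurable x
    have h2 : ‖TK K f x‖ₑ ≤ ∫⁻ y, ‖k y‖ₑ * ‖f (x - y)‖ₑ := by
      rw [TK, hK]
      refine (enorm_integral_le_lintegral_enorm _).trans (le_of_eq ?_)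
      congr 1; ext y; rw [reflectTranslate_apply, enorm_mul]
    have h3 := ENNReal.toReal_mono
      (ENNReal.mul_lt_top hkN (schwartz_lorentz_lt_top hd hp hq f)).ne (h2.trans h1)
    rw [ENNReal.toReal_mul, toReal_enorm] at h3
    exact h3
  have := norm_integral_le_of_norm_le (f := fun x => TK K f x * g x)
    (g := fun x => A * B * ‖g x‖) (g.integrable.norm.const_mul _) (Eventually.of_forall fun x => by
      simp only [norm_mul]
      gcongr
      exact hb x) (μ := volume)
  refine this.trans (le_of_eq ?_)
  rw [integral_const_mul]; ring
end SchwartzLorentz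

section PartTwo

lemma cont_of_approx {X : Type*} [TopologicalSpace X] {f : X → ℂ}
    (h : ∀ ε : ℝ, 0 < ε → ∃ F : X → ℂ, Continuous F ∧ ∀ y, ‖f y - F y‖ < ε) : Continuous f := by
  apply continuous_of_uniform_approx_of_continuous
  intro u hu
  obtain ⟨ε, hε, hu⟩ := Metric.mem_uniformity_dist.1 hu
  obtain ⟨F, hF, hy⟩ := h ε hε
  exact ⟨F, hF, fun y => hu (by rw [dist_eq_norm]; exact hy y)⟩

lemma lorentz_weak {α : Type*} [MeasurableSpace α] {μ : Measure α} {p q : ℝ≥0∞} (hq : q ≠ 0)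
    {f : α → ℂ} (hf : lorentzNorm μ p q f < ∞) :
    ∃ B : ℝ≥0∞, B < ∞ ∧ ∀ T : ℝ, 0 < T →
      ENNReal.ofReal (T ^ (1/p).toReal) * rearrangement μ f (2 * T) ≤ B := by
  by_cases hqt : q = ∞
  · refine ⟨_, hf, fun T hT => ?_⟩
    simp only [lorentzNorm, if_pos hqt]
    refine le_trans ?_ (le_iSup _ (⟨T, hT⟩ : Ioi (0:ℝ)))
    gcongr
    exact rearr_antitone f (by linarith)
  · have hq0 : 0 < q.toReal := ENNReal.toReal_pos hq hqt
    simp only [lorentzNorm, if_neg hqt] at hf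
    set I := ∫⁻ t in Ioi (0:ℝ),
      (ENNReal.ofReal (t ^ (1/p).toReal) * rearrangement μ f t) ^ q.toReal / ENNReal.ofReal t with hI
    have hIt : I < ∞ := by
      by_contra h
      push Not at h
      rw [top_le_iff.1 h, ENNReal.top_rpow_of_pos (by positivity)] at hf
      exact lt_irrefl _ hf
    refine ⟨(2 * I) ^ (1 / q.toReal), ENNReal.rpow_lt_top_of_nonneg (by positivity)
      (ENNReal.mul_ne_top (by simp) hIt.ne), fun T hT => ?_⟩
    set X := ENNReal.ofReal (T ^ (1/p).toReal) * rearrangement μ f (2 * T)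
    have h1 : X ^ q.toReal / ENNReal.ofReal (2 * T) * ENNReal.ofReal T ≤ I := by
      calc _ = ∫⁻ t in Ioc T (2 * T), X ^ q.toReal / ENNReal.ofReal (2 * T) := by
            rw [setLIntegral_const, Real.volume_Ioc]; congr 2; ring
        _ ≤ ∫⁻ t in Ioc T (2 * T),
            (ENNReal.ofReal (t ^ (1/p).toReal) * rearrangement μ f t) ^ q.toReal / ENNReal.ofReal t := by
            refine setLIntegral_mono' measurableSet_Ioc fun t ht => ?_
            have := rearr_antitone (μ := μ) f ht.2
            have h2 := ht.1.le
            have h3 := ht.2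
            simp only [X]
            gcongr
        _ ≤ I := lintegral_mono_set fun t ht => lt_trans hT ht.1
    have h2 : X ^ q.toReal ≤ 2 * I := by
      have e : ENNReal.ofReal (2 * T) = 2 * ENNReal.ofReal T := by
        rw [ENNReal.ofReal_mul (by norm_num)]; simp
      calc X ^ q.toReal = 2 * (X ^ q.toReal / ENNReal.ofReal (2 * T) * ENNReal.ofReal T) := by
            rw [e]
            have hT0 : ENNReal.ofReal T ≠ 0 := by simpa using hT
            rw [div_eq_mul_inv, ENNReal.mul_inv (by simp) (by simp)]
            calc X ^ q.toReal = X ^ q.toReal * (2 * 2⁻¹) * (ENNReal.ofReal T * (ENNReal.ofReal T)⁻¹) := by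
                  rw [ENNReal.mul_inv_cancel hT0 (by simp), ENNReal.mul_inv_cancel (by simp) (by simp)]
                  simp
              _ = _ := by ring
        _ ≤ _ := by gcongr
    calc X = (X ^ q.toReal) ^ (1 / q.toReal) := by
          rw [← ENNReal.rpow_mul, mul_one_div_cancel hq0.ne', ENNReal.rpow_one]
      _ ≤ _ := by gcongr

lemma rearr_lt_top {α : Type*} [MeasurableSpace α] {μ : Measure α} {p q : ℝ≥0∞} (hq : q ≠ 0)
    {f : α → ℂ} (hf : lorentzNorm μ p q f < ∞) {t : ℝ} (ht : 0 < t) :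
    rearrangement μ f t < ∞ := by
  obtain ⟨B, hB, h⟩ := lorentz_weak hq hf
  have := h (t/2) (by linarith)
  rw [mul_div_cancel₀ t two_ne_zero] at this
  by_contra hh
  push Not at hh
  rw [top_le_iff.1 hh, ENNReal.mul_top] at this
  · exact absurd (top_le_iff.1 this) hB.ne
  · simp; positivity

lemma distrib_lt_top {α : Type*} [MeasurableSpace α] {μ : Measure α} {p : ℝ} (hp : 1 ≤ p)
    {q : ℝ≥0∞} (hq : q ≠ 0)
    {f : α → ℂ} (hf : lorentzNorm μ (ENNReal.ofReal p) q f < ∞) {c : ℝ} (hc : 0 < c) :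
    distribFn μ f (ENNReal.ofReal c) < ∞ := by
  obtain ⟨B, hB, h⟩ := lorentz_weak hq hf
  have hpr : (1 / ENNReal.ofReal p).toReal = 1 / p := by
    rw [ENNReal.toReal_div, ENNReal.toReal_ofReal (by linarith)]; simp
  rw [hpr] at h
  by_contra hh
  push Not at hh
  have hh := top_le_iff.1 hh
  have h1 : ∀ T : ℝ, ENNReal.ofReal c ≤ rearrangement μ f T := fun T =>
    le_rearr (by rw [hh]; exact ENNReal.ofReal_lt_top)
  set b := B.toReal
  have hb : 0 ≤ b := ENNReal.toReal_nonneg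
  have h2 := h ((b / c + 1) ^ p) (by positivity)
  rw [← Real.rpow_mul (by positivity), mul_one_div_cancel (by linarith), Real.rpow_one] at h2
  have h3 : ENNReal.ofReal ((b / c + 1) * c) ≤ B := by
    rw [ENNReal.ofReal_mul (by positivity)]
    exact (mul_le_mul_right (h1 _) _).trans h2
  rw [← ENNReal.ofReal_toReal hB.ne, ENNReal.ofReal_le_ofReal_iff hb] at h3
  have : (b / c + 1) * c = b + c := by field_simp
  rw [this] at h3
  change b + c ≤ b at h3
  linarith

lemma conv_cont_L1_Linf {d : ℕ} {a b : Ed d → ℂ} (ha : Integrable a) (hb : Measurable b) {M : ℝ}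
    (hM : ∀ x, ‖b x‖ ≤ M) : Continuous fun x => ∫ y, a y * b (x - y) := by
  have hM0 : 0 ≤ M := (norm_nonneg _).trans (hM 0)
  apply cont_of_approx
  intro ε hε
  obtain ⟨g, hg1, hg2, hg3, hg4⟩ := ha.exists_hasCompactSupport_integral_sub_le
    (show 0 < ε / (2 * (M + 1)) by positivity)
  refine ⟨fun x => ∫ y, g y * b (x - y), ?_, fun x => ?_⟩
  · have hbl : LocallyIntegrable b := by
      refine (locallyIntegrable_const M).mono hb.aestronglyMeasurable (Eventually.of_forall fun x => ?_)
      exact (hM x).trans (Real.le_norm_self M)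
    have := hg1.continuous_convolution_left (ContinuousLinearMap.mul ℂ ℂ) hg3 hbl
    exact this
  · have hbm : AEStronglyMeasurable (fun y => b (x - y)) volume :=
      (hb.comp (measurable_const.sub measurable_id)).aestronglyMeasurable
    have i1 : Integrable fun y => a y * b (x - y) := ha.mul_bdd hbm
      (Eventually.of_forall fun y => hM _)
    have i2 : Integrable fun y => g y * b (x - y) := hg4.mul_bdd hbm
      (Eventually.of_forall fun y => hM _)
    rw [← integral_sub i1 i2]
    calc _ ≤ ∫ y, ‖a y - g y‖ * M := by
          refine norm_integral_le_of_norm_le ((ha.sub hg4).norm.mul_const M)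
            (Eventually.of_forall fun y => ?_)
          rw [← sub_mul, norm_mul]
          exact mul_le_mul_of_nonneg_left (hM _) (norm_nonneg _)
      _ = (∫ y, ‖a y - g y‖) * M := integral_mul_const _ _
      _ ≤ ε / (2 * (M + 1)) * M := by gcongr
      _ < ε := by
          rw [div_mul_eq_mul_div, div_lt_iff₀ (by positivity)]
          nlinarith

lemma lorentz_indicator {α : Type*} [MeasurableSpace α] {μ : Measure α} {p q : ℝ}
    (hp : 1 ≤ p) (hq : 1 ≤ q) {E : Set α} (hE : μ E < ∞) :
    lorentzNorm μ (ENNReal.ofReal p) (ENNReal.ofReal q) (E.indicator fun _ => (1:ℂ)) < ∞ := by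
  have hr : ∀ t, rearrangement μ (E.indicator fun _ => (1:ℂ)) t ≤ 1 := by
    intro t
    apply rearr_le
    have : {x | (1:ℝ≥0∞) < (‖E.indicator (fun _ => (1:ℂ)) x‖₊ : ℝ≥0∞)} = ∅ := by
      ext x
      by_cases hx : x ∈ E <;> simp [hx]
    rw [distribFn, this]; simp
  set M := max 1 ((μ E).toReal ^ 2)
  have hM : 1 ≤ M := le_max_left _ _
  refine lorentz_finite_of_decay hp hq (M := M) (by positivity) (fun t ht => ?_) (fun t ht => ?_)
  · refine (hr t).trans ?_
    rw [← ENNReal.ofReal_one]; exact ENNReal.ofReal_le_ofReal hM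
  · by_cases h : μ E ≤ ENNReal.ofReal t
    · refine (rearr_le (s := 0) ?_).trans zero_le
      refine le_trans (measure_mono fun x hx => ?_) h
      by_contra hxE
      simp [hxE] at hx
    · push Not at h
      have h1 : t < (μ E).toReal := by
        rw [← ENNReal.ofReal_toReal hE.ne] at h
        exact (ENNReal.ofReal_lt_ofReal_iff_of_nonneg ht.le).1 h
      refine (hr t).trans ?_
      rw [← ENNReal.ofReal_one]; apply ENNReal.ofReal_le_ofReal
      rw [le_div_iff₀ (by positivity), one_mul]
      exact (pow_le_pow_left₀ ht.le h1.le 2).trans (le_max_right _ _)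
end PartTwo

section PartTwoB

/-- truncation -/
def truncL {α : Type*} (h : α → ℂ) (n : ℕ) : α → ℂ :=
  {x | 1 / ((n:ℝ) + 1) < ‖h x‖ ∧ ‖h x‖ ≤ n}.indicator h

lemma truncL_measurable {α : Type*} [MeasurableSpace α] {h : α → ℂ} (hh : Measurable h) (n : ℕ) :
    Measurable (truncL h n) :=
  hh.indicator ((measurableSet_lt measurable_const hh.norm).inter
    (measurableSet_le hh.norm measurable_const))

lemma truncL_or {α : Type*} (h : α → ℂ) (n : ℕ) (x : α) : truncL h n x = h x ∨ truncL h n x = 0 := by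
  by_cases hc : x ∈ {x | 1 / ((n:ℝ) + 1) < ‖h x‖ ∧ ‖h x‖ ≤ n}
  · left; rw [truncL, Set.indicator_of_mem hc]
  · right; rw [truncL, Set.indicator_of_notMem hc]

lemma truncL_tendsto {α : Type*} [MeasurableSpace α] {μ : Measure α} {p q : ℝ}
    (hq : 1 ≤ q) {h : α → ℂ}
    (hN : lorentzNorm μ (ENNReal.ofReal p) (ENNReal.ofReal q) h < ∞) :
    Tendsto (fun n => lorentzNorm μ (ENNReal.ofReal p) (ENNReal.ofReal q)
      (fun x => h x - truncL h n x)) atTop (𝓝 0) := by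
  have hq0 : ENNReal.ofReal q ≠ 0 := by simp; linarith
  have hqr : (ENNReal.ofReal q).toReal = q := ENNReal.toReal_ofReal (by linarith)
  have hle : ∀ n t, rearrangement μ (fun x => h x - truncL h n x) t ≤ rearrangement μ h t := by
    intro n t
    refine rearr_mono_distrib (fun s => measure_mono fun x hx => ?_) t
    have hx' : s < (‖h x - truncL h n x‖₊ : ℝ≥0∞) := hx
    refine lt_of_lt_of_le hx' (ENNReal.coe_le_coe.2 ?_)
    rcases truncL_or h n x with hc | hc <;> rw [hc] <;> simp
  have hlim : ∀ t, 0 < t → Tendsto (fun n => rearrangement μ (fun x => h x - truncL h n x) t)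
      atTop (𝓝 0) := by
    intro t ht
    have hfin := rearr_lt_top hq0 hN ht
    have hz : Tendsto (fun n : ℕ => ENNReal.ofReal (1 / ((n:ℝ) + 1))) atTop (𝓝 0) := by
      have := ENNReal.tendsto_ofReal (tendsto_one_div_add_atTop_nhds_zero_nat (𝕜 := ℝ))
      simpa using this
    refine tendsto_of_tendsto_of_tendsto_of_le_of_le' tendsto_const_nhds hz
      (Eventually.of_forall fun n => zero_le) ?_
    obtain ⟨n0, hn0⟩ := exists_nat_gt (rearrangement μ h t).toReal
    filter_upwards [eventually_ge_atTop n0] with n hn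
    apply rearr_le
    have h1 : rearrangement μ h t < (n:ℝ≥0∞) := by
      rw [← ENNReal.ofReal_toReal hfin.ne, ← ENNReal.ofReal_natCast]
      rw [ENNReal.ofReal_lt_ofReal_iff_of_nonneg ENNReal.toReal_nonneg]
      exact lt_of_lt_of_le hn0 (by exact_mod_cast hn)
    obtain ⟨s, hs, hsn⟩ := sInf_lt_iff.1 h1
    refine le_trans ?_ (show distribFn μ h s ≤ ENNReal.ofReal t from hs)
    refine measure_mono fun x hx => ?_
    have hx' : ENNReal.ofReal (1 / ((n:ℝ)+1)) < (‖h x - truncL h n x‖₊ : ℝ≥0∞) := hx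
    rw [← enorm_eq_nnnorm, ← ofReal_norm,
      ENNReal.ofReal_lt_ofReal_iff_of_nonneg (by positivity)] at hx'
    refine lt_of_lt_of_le hsn ?_
    rw [← enorm_eq_nnnorm, ← ofReal_norm, ← ENNReal.ofReal_natCast]
    apply ENNReal.ofReal_le_ofReal
    by_contra hlt
    push Not at hlt
    by_cases hc : x ∈ {x | 1 / ((n:ℝ) + 1) < ‖h x‖ ∧ ‖h x‖ ≤ n}
    · simp only [truncL, Set.indicator_of_mem hc, sub_self, norm_zero] at hx'
      have : (0:ℝ) < 1 / ((n:ℝ)+1) := by positivity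
      linarith
    · simp only [truncL, Set.indicator_of_notMem hc, sub_zero] at hx'
      exact hc ⟨hx', hlt.le⟩
  simp only [lorentzNorm, if_neg ENNReal.ofReal_ne_top, hqr] at hN ⊢
  set I := ∫⁻ t in Ioi (0:ℝ),
      (ENNReal.ofReal (t ^ (1/ENNReal.ofReal p).toReal) * rearrangement μ h t) ^ q / ENNReal.ofReal t with hI
  have hIt : I ≠ ∞ := by
    intro h
    rw [h, ENNReal.top_rpow_of_pos (by positivity)] at hN
    exact lt_irrefl _ hN
  have hT : Tendsto (fun n => ∫⁻ t in Ioi (0:ℝ),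
      (ENNReal.ofReal (t ^ (1/ENNReal.ofReal p).toReal) *
        rearrangement μ (fun x => h x - truncL h n x) t) ^ q / ENNReal.ofReal t) atTop (𝓝 0) := by
    have := tendsto_lintegral_of_dominated_convergence (μ := volume.restrict (Ioi (0:ℝ)))
      (F := fun n t => (ENNReal.ofReal (t ^ (1/ENNReal.ofReal p).toReal) *
        rearrangement μ (fun x => h x - truncL h n x) t) ^ q / ENNReal.ofReal t) (f := fun _ => 0)
      (fun t => (ENNReal.ofReal (t ^ (1/ENNReal.ofReal p).toReal) * rearrangement μ h t) ^ q / ENNReal.ofReal t)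
      (fun n => by
        refine Measurable.div (Measurable.pow_const (Measurable.mul ?_ (rearr_measurable _)) _)
          ENNReal.measurable_ofReal
        exact ENNReal.measurable_ofReal.comp (measurable_id.pow_const _))
      (fun n => Eventually.of_forall fun t => by
        have := hle n t
        simp only
        gcongr) hIt
      (by
        filter_upwards [ae_restrict_mem measurableSet_Ioi] with t ht
        have ht : 0 < t := ht
        have a1 : Tendsto (fun n => ENNReal.ofReal (t ^ (1/ENNReal.ofReal p).toReal) *
            rearrangement μ (fun x => h x - truncL h n x) t) atTop (𝓝 0) := by
          have := ENNReal.Tendsto.const_mul (hlim t ht)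
            (Or.inr (ENNReal.ofReal_ne_top (r := t ^ (1/ENNReal.ofReal p).toReal)))
          simpa using this
        have a2 := a1.ennrpow_const q
        rw [ENNReal.zero_rpow_of_pos (by linarith)] at a2
        have a3 := ENNReal.Tendsto.div_const a2 (b := ENNReal.ofReal t) (by simp [ht])
        simpa using a3)
    simpa using this
  have := hT.ennrpow_const (1/q)
  rwa [ENNReal.zero_rpow_of_pos (by positivity)] at this

lemma conv_integrable {d : ℕ} {p q : ℝ} (hp : 1 ≤ p) (hq : 1 ≤ q) {p' q' : ℝ≥0∞}
    (hp' : 1 / ENNReal.ofReal p + 1 / p' = 1)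
    (hq' : 1 / ENNReal.ofReal q + 1 / q' = 1) {k h : Ed d → ℂ} (hk : Measurable k)
    (hh : Measurable h) (hkN : lorentzNorm volume p' q' k < ∞)
    (hhN : lorentzNorm volume (ENNReal.ofReal p) (ENNReal.ofReal q) h < ∞) (x : Ed d) :
    Integrable fun y => k y * h (x - y) := by
  refine ⟨(hk.mul (hh.comp (measurable_const.sub measurable_id))).aestronglyMeasurable, ?_⟩
  refine lt_of_le_of_lt ?_ (ENNReal.mul_lt_top hkN hhN)
  refine le_trans (le_of_eq ?_) (conv_enorm_le hp hq hp' hq' hk hh x)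
  congr 1; ext y; simp [enorm_mul]

lemma conv_continuous {d : ℕ} {p q : ℝ} (hp : 1 ≤ p) (hq : 1 ≤ q) {p' q' : ℝ≥0∞}
    (hp' : 1 / ENNReal.ofReal p + 1 / p' = 1)
    (hq' : 1 / ENNReal.ofReal q + 1 / q' = 1) {k h : Ed d → ℂ} (hk : Measurable k)
    (hh : Measurable h) (hkN : lorentzNorm volume p' q' k < ∞)
    (hhN : lorentzNorm volume (ENNReal.ofReal p) (ENNReal.ofReal q) h < ∞) :
    Continuous fun x => ∫ y, k y * h (x - y) := by
  have hq0 : ENNReal.ofReal q ≠ 0 := by simp; linarith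
  have hq'0 : q' ≠ 0 := by rintro rfl; simp at hq'
  obtain ⟨c, hc, hct⟩ := sInf_lt_iff.1 (rearr_lt_top hq'0 hkN one_pos)
  have hc0 : distribFn volume k c < ∞ := lt_of_le_of_lt hc ENNReal.ofReal_lt_top
  set E : Set (Ed d) := {x | c < (‖k x‖₊ : ℝ≥0∞)} with hE
  have hEm : MeasurableSet E := measurableSet_lt measurable_const hk.nnnorm.coe_nnreal_ennreal
  have hEf : volume E < ∞ := hc0
  have hk1 : Integrable (E.indicator k) := by
    refine ⟨(hk.indicator hEm).aestronglyMeasurable, ?_⟩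
    refine lt_of_le_of_lt ?_ (ENNReal.mul_lt_top hkN (lorentz_indicator hp hq hEf))
    refine le_trans (le_of_eq ?_) (holder_lorentz hp hq hp' hq' hk (measurable_const.indicator hEm))
    congr 1; ext x
    by_cases hx : x ∈ E <;> simp [hx]
  have hk2m : Measurable (Eᶜ.indicator k) := hk.indicator hEm.compl
  have hk2 : ∀ x, ‖Eᶜ.indicator k x‖ ≤ c.toReal := by
    intro x
    by_cases hx : x ∈ E
    · simp [hx]
    · simp only [mem_compl_iff, hx, not_false_eq_true, indicator_of_mem]
      have : (‖k x‖₊ : ℝ≥0∞) ≤ c := not_lt.1 hx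
      exact ENNReal.toReal_mono hct.ne this
  have hcn : ∀ n, Continuous fun x => ∫ y, k y * truncL h n (x - y) := by
    intro n
    have hm := truncL_measurable hh n
    have hb : ∀ x, ‖truncL h n x‖ ≤ n := by
      intro x
      by_cases hc : x ∈ {x | 1 / ((n:ℝ) + 1) < ‖h x‖ ∧ ‖h x‖ ≤ n}
      · simp only [truncL, Set.indicator_of_mem hc]; exact hc.2
      · rw [truncL, Set.indicator_of_notMem hc]; simp
    have hi : Integrable (truncL h n) := by
      have hfin := distrib_lt_top hp hq0 hhN (c := 1 / ((n:ℝ)+1)) (by positivity)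
      have hS : {x | 1 / ((n:ℝ) + 1) < ‖h x‖ ∧ ‖h x‖ ≤ n} ⊆
          {x | ENNReal.ofReal (1 / ((n:ℝ)+1)) < (‖h x‖₊ : ℝ≥0∞)} := by
        intro x hx
        change ENNReal.ofReal (1 / ((n:ℝ)+1)) < (‖h x‖₊ : ℝ≥0∞)
        rw [← enorm_eq_nnnorm, ← ofReal_norm,
          ENNReal.ofReal_lt_ofReal_iff_of_nonneg (by positivity)]
        exact hx.1
      have hSm : MeasurableSet {x | 1 / ((n:ℝ) + 1) < ‖h x‖ ∧ ‖h x‖ ≤ n} :=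
        (measurableSet_lt measurable_const hh.norm).inter
          (measurableSet_le hh.norm measurable_const)
      rw [truncL, integrable_indicator_iff hSm]
      refine Measure.integrableOn_of_bounded (M := n)
        (lt_of_le_of_lt (measure_mono hS) hfin).ne hh.aestronglyMeasurable ?_
      filter_upwards [ae_restrict_mem hSm] with x hx
      exact hx.2
    have c1 := conv_cont_L1_Linf hk1 hm hb
    have c2 := conv_cont_L1_Linf hi hk2m hk2
    refine (c1.add c2).congr fun x => ?_
    have e2 : ∫ y, truncL h n y * Eᶜ.indicator k (x - y) = ∫ y, Eᶜ.indicator k y * truncL h n (x - y) := by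
      rw [← integral_sub_left_eq_self _ volume x]
      congr 1; ext y; simp [mul_comm]
    change (∫ y, E.indicator k y * truncL h n (x - y)) + (∫ y, truncL h n y * Eᶜ.indicator k (x - y)) = _
    rw [e2, ← integral_add]
    · congr 1; ext y
      by_cases hy : y ∈ E <;> simp [hy]
    · exact hk1.mul_bdd (c := n) (hm.comp (measurable_const.sub measurable_id)).aestronglyMeasurable
        (Eventually.of_forall fun y => hb _)
    · exact (hi.comp_sub_left x).bdd_mul (c := c.toReal) hk2m.aestronglyMeasurable
        (Eventually.of_forall fun y => hk2 _)
  apply cont_of_approx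
  intro ε hε
  have hlim := ENNReal.Tendsto.const_mul (truncL_tendsto hq hhN)
    (Or.inr hkN.ne)
  rw [mul_zero] at hlim
  obtain ⟨n, hn⟩ := (hlim.eventually (gt_mem_nhds (ENNReal.ofReal_pos.2 hε))).exists
  refine ⟨_, hcn n, fun x => ?_⟩
  have hle : lorentzNorm volume (ENNReal.ofReal p) (ENNReal.ofReal q) (truncL h n) ≤
      lorentzNorm volume (ENNReal.ofReal p) (ENNReal.ofReal q) h := lorentz_mono _ _ fun x => by
    rcases truncL_or h n x with hc | hc <;> rw [hc] <;> simp
  rw [← integral_sub (conv_integrable hp hq hp' hq' hk hh hkN hhN x)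
    (conv_integrable hp hq hp' hq' hk (truncL_measurable hh n) hkN (hle.trans_lt hhN) x)]
  have b1 := conv_enorm_le hp hq hp' hq' hk (h := fun x => h x - truncL h n x)
    (hh.sub (truncL_measurable hh n)) x
  have b2 : ‖∫ y, (k y * h (x - y) - k y * truncL h n (x - y))‖ₑ < ENNReal.ofReal ε := by
    refine lt_of_le_of_lt ((enorm_integral_le_lintegral_enorm _).trans ?_) hn
    refine le_trans (le_of_eq ?_) b1
    congr 1; ext y; rw [← mul_sub, enorm_mul]
  rwa [← ofReal_norm, ENNReal.ofReal_lt_ofReal_iff hε] at b2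

lemma distrib_comp_smul {d : ℕ} (k : Ed d → ℂ) {t : ℝ} (ht : 1 ≤ t) (s : ℝ≥0∞) :
    distribFn volume (fun y => k (t • y)) s ≤ distribFn volume k s := by
  have h := Measure.addHaar_preimage_smul (volume : Measure (Ed d)) (r := t) (by linarith)
    {x | s < (‖k x‖₊ : ℝ≥0∞)}
  unfold distribFn
  refine (le_of_eq h).trans ?_
  refine mul_le_of_le_one_left zero_le ?_
  rw [← ENNReal.ofReal_one]
  apply ENNReal.ofReal_le_ofReal
  rw [abs_of_nonneg (by positivity)]
  exact inv_le_one_of_one_le₀ (one_le_pow₀ ht)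

lemma lorentz_comp_smul {d : ℕ} (p q : ℝ≥0∞) (k : Ed d → ℂ) {t : ℝ} (ht : 1 ≤ t) :
    lorentzNorm volume p q (fun y => k (t • y)) ≤ lorentzNorm volume p q k :=
  lorentz_mono_rearr p q fun τ _ => rearr_mono_distrib (fun s => distrib_comp_smul k ht s) τ

lemma part_ii {d : ℕ} {p q : ℝ} (hp : 1 ≤ p) (hq : 1 ≤ q) {p' q' : ℝ≥0∞}
    (hp' : 1 / ENNReal.ofReal p + 1 / p' = 1)
    (hq' : 1 / ENNReal.ofReal q + 1 / q' = 1) {k f : Ed d → ℂ} (hk : Measurable k)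
    (hkN : lorentzNorm volume p' q' k < ∞) (hf : Measurable f)
    (hfN : lorentzNorm volume (ENNReal.ofReal p) (ENNReal.ofReal q) f < ∞) :
    Measurable (fun x : Ed d => ⨆ (t : ℝ) (_ : 0 < t),
          (‖∫ y : Ed d, ((t ^ d : ℝ) : ℂ) * k (t • y) * f (x - y)‖₊ : ℝ≥0∞)) := by
  have hc : ∀ t : ℝ, 0 < t → Continuous fun x : Ed d =>
      ∫ y : Ed d, ((t ^ d : ℝ) : ℂ) * k (t • y) * f (x - y) := by
    intro t ht
    rcases le_total 1 t with h1 | h1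
    · have hcont := conv_continuous hp hq hp' hq' (k := fun y => k (t • y))
        (hk.comp (measurable_const_smul t)) hf ((lorentz_comp_smul _ _ k h1).trans_lt hkN) hfN
      refine (continuous_const.mul hcont).congr (f := fun x => ((t ^ d : ℝ) : ℂ) * ∫ y, k (t • y) * f (x - y)) fun x => ?_
      rw [← integral_const_mul]
      congr 1; ext y; ring
    · have hcont := conv_continuous hp hq hp' hq' (h := fun y => f (t⁻¹ • y)) hk
        (hf.comp (measurable_const_smul t⁻¹)) hkN
        ((lorentz_comp_smul _ _ f ((one_le_inv₀ ht).2 h1)).trans_lt hfN)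
      refine (hcont.comp (continuous_const_smul t)).congr fun x => ?_
      have := Measure.integral_comp_smul (volume : Measure (Ed d))
        (fun y => k y * f (t⁻¹ • (t • x - y))) t
      simp only [smul_sub, smul_smul, inv_mul_cancel₀ ht.ne', one_smul, finrank_euclideanSpace,
        Fintype.card_fin] at this
      simp only [Function.comp_apply, smul_sub, smul_smul, inv_mul_cancel₀ ht.ne', one_smul, mul_assoc]
      rw [integral_const_mul, this, abs_of_nonneg (by positivity), Complex.real_smul, ← mul_assoc,
        ← Complex.ofReal_mul, mul_inv_cancel₀ (by positivity)]
      simp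
  apply LowerSemicontinuous.measurable
  refine lowerSemicontinuous_biSup fun t ht => Continuous.lowerSemicontinuous ?_
  exact ENNReal.continuous_coe.comp (hc t ht).nnnorm

end PartTwoB

section Converse

lemma sum_quarter (J : Finset ℤ) : ∀ m : ℤ, (∀ j ∈ J, j ≤ m) →
    ∑ j ∈ J, 3 / 4 * (4:ℝ) ^ j ≤ 4 ^ m := by
  induction J using Finset.induction_on_max with
  | empty => intro m _; simp; positivity
  | insert a J hJ ih =>
    intro m hm
    have ha : a ∉ J := fun h => lt_irrefl _ (hJ a h)
    rw [Finset.sum_insert ha]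
    have h1 := ih (a - 1) (fun j hj => by have := hJ j hj; omega)
    have h2 : (4:ℝ) ^ (a - 1) = 4 ^ a / 4 := by rw [zpow_sub_one₀ (by norm_num)]; ring
    have h3 : (4:ℝ) ^ a ≤ 4 ^ m := zpow_le_zpow_right₀ (by norm_num) (hm a (by simp))
    linarith

lemma sum_quarter' (J : Finset ℤ) {t : ℝ} (ht : 0 < t) (h : ∀ j ∈ J, (4:ℝ) ^ j ≤ t) :
    ∑ j ∈ J, 3 / 4 * (4:ℝ) ^ j ≤ t := by
  rcases J.eq_empty_or_nonempty with rfl | hne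
  · simpa using ht.le
  · exact (sum_quarter J (J.max' hne) fun j hj => J.le_max' j hj).trans (h _ (J.max'_mem hne))

lemma exists_compact_measure {d : ℕ} (hd : d ≠ 0) {G : Set (Ed d)} (hG : MeasurableSet G) {m : ℝ}
    (hm : 0 ≤ m) (h : ENNReal.ofReal m < volume G) :
    ∃ D, D ⊆ G ∧ IsCompact D ∧ volume D = ENNReal.ofReal m := by
  obtain ⟨D, hDG, hDc, hD⟩ := hG.exists_lt_isCompact h
  obtain ⟨R, hR⟩ := hDc.isBounded.subset_closedBall (0 : Ed d)
  set F : ℝ → ℝ := fun r => (volume (D ∩ Metric.closedBall 0 r)).toReal with hF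
  set V : ℝ := (volume (Metric.closedBall (0 : Ed d) 1)).toReal with hV
  have hfin : ∀ r, volume (D ∩ Metric.closedBall 0 r) ≠ ∞ := fun r =>
    ((measure_mono inter_subset_left).trans_lt hDc.measure_lt_top).ne
  have hball : ∀ r : ℝ, 0 ≤ r → (volume (Metric.closedBall (0 : Ed d) r)).toReal = r ^ d * V := by
    intro r hr
    rw [Measure.addHaar_closedBall' _ _ hr, ENNReal.toReal_mul, ENNReal.toReal_ofReal (by positivity)]
    simp [hV]
  have hle : ∀ r s : ℝ, 0 ≤ r → r ≤ s → F s - F r ≤ s ^ d * V - r ^ d * V ∧ 0 ≤ F s - F r := by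
    intro r s hr hrs
    have hsub : Metric.closedBall (0 : Ed d) r ⊆ Metric.closedBall 0 s :=
      Metric.closedBall_subset_closedBall hrs
    constructor
    · have h1 : volume (D ∩ Metric.closedBall 0 s) ≤ volume (D ∩ Metric.closedBall 0 r) +
          volume (Metric.closedBall (0 : Ed d) s \ Metric.closedBall 0 r) := by
        refine (measure_mono ?_).trans (measure_union_le _ _)
        rintro x ⟨hx, hxs⟩
        by_cases hxr : x ∈ Metric.closedBall (0 : Ed d) r
        · exact Or.inl ⟨hx, hxr⟩
        · exact Or.inr ⟨hxs, hxr⟩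
      have hdf : volume (Metric.closedBall (0 : Ed d) s \ Metric.closedBall 0 r) ≠ ∞ :=
        ((measure_mono sdiff_subset).trans_lt measure_closedBall_lt_top).ne
      have h2 := ENNReal.toReal_mono (ENNReal.add_ne_top.2 ⟨hfin r, hdf⟩) h1
      rw [ENNReal.toReal_add (hfin r) hdf,
        measure_sdiff hsub measurableSet_closedBall.nullMeasurableSet
          measure_closedBall_lt_top.ne, ENNReal.toReal_sub_of_le (measure_mono hsub)
          measure_closedBall_lt_top.ne, hball s (hr.trans hrs), hball r hr] at h2
      simp only [hF]; linarith
    · have := ENNReal.toReal_mono (hfin s) (measure_mono (inter_subset_inter_right D hsub))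
      simp only [hF]; linarith
  have hcont : ContinuousOn F (Icc 0 (max R 0)) := by
    have hc : Continuous fun r : ℝ => r ^ d * V := by fun_prop
    rw [Metric.continuousOn_iff]
    intro r hr ε hε
    obtain ⟨δ, hδ, h⟩ := Metric.continuous_iff.1 hc r ε hε
    refine ⟨δ, hδ, fun s hs hsr => lt_of_le_of_lt ?_ (h s hsr)⟩
    simp only [Real.dist_eq]
    rcases le_total r s with hrs | hrs
    · obtain ⟨a1, a2⟩ := hle r s hr.1 hrs
      rw [abs_of_nonneg a2]
      exact a1.trans (le_abs_self _)
    · obtain ⟨a1, a2⟩ := hle s r hs.1 hrs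
      rw [abs_sub_comm, abs_of_nonneg a2, abs_sub_comm]
      exact a1.trans (le_abs_self _)
  have h0 : F 0 = 0 := by
    have : volume (D ∩ Metric.closedBall (0 : Ed d) 0) = 0 := by
      refine measure_mono_null inter_subset_right ?_
      have : Nonempty (Fin d) := ⟨⟨0, Nat.pos_of_ne_zero hd⟩⟩
      simp
    simp only [hF]; rw [this]; simp
  have h1 : m ≤ F (max R 0) := by
    have : D ∩ Metric.closedBall 0 (max R 0) = D :=
      inter_eq_left.2 (hR.trans (Metric.closedBall_subset_closedBall (le_max_left _ _)))
    simp only [hF, this]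
    exact (ENNReal.ofReal_le_iff_le_toReal hDc.measure_lt_top.ne).1 hD.le
  obtain ⟨r, hr, hrm⟩ := intermediate_value_Icc (le_max_right R 0) hcont
    (show m ∈ Icc (F 0) (F (max R 0)) from ⟨by rw [h0]; exact hm, h1⟩)
  refine ⟨D ∩ Metric.closedBall 0 r, inter_subset_left.trans hDG,
    hDc.inter_right Metric.isClosed_closedBall, ?_⟩
  rw [← hrm, hF, ENNReal.ofReal_toReal (hfin r)]

lemma lorentz_step {α : Type*} [MeasurableSpace α] {μ : Measure α} {p q : ℝ} (hp : 1 ≤ p)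
    (hq : 1 ≤ q) (J : Finset ℤ) {b : ℤ → ℝ} (hb : ∀ j, 0 ≤ b j) {U : ℤ → Set α}
    (hU : ∀ j ∈ J, μ (U j) ≤ ENNReal.ofReal (3/4 * 4 ^ j)) {g : α → ℂ}
    (hg : ∀ s : ℝ, 0 ≤ s → ∀ x, s < ‖g x‖ → ∃ j ∈ J, s < b j ∧ x ∈ U j) :
    lorentzNorm μ (ENNReal.ofReal p) (ENNReal.ofReal q) g ≤
      ENNReal.ofReal ((p / q * ∑ j ∈ J, b j ^ q * ((4:ℝ) ^ j) ^ (q / p)) ^ (1/q)) := by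
  have hqr : (ENNReal.ofReal q).toReal = q := ENNReal.toReal_ofReal (by linarith)
  have hpr : (1 / ENNReal.ofReal p).toReal = 1 / p := by
    rw [ENNReal.toReal_div, ENNReal.toReal_ofReal (by linarith)]; simp
  have hq0 : 0 < q := by linarith
  have hp0 : 0 < p := by linarith
  have hb' : ∀ j, 0 ≤ b j ^ q := fun j => Real.rpow_nonneg (hb j) q
  simp only [lorentzNorm, if_neg ENNReal.ofReal_ne_top, hqr, hpr]
  have hsum0 : 0 ≤ ∑ j ∈ J, b j ^ q * ((4:ℝ) ^ j) ^ (q / p) :=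
    Finset.sum_nonneg fun j _ => mul_nonneg (hb' j) (by positivity)
  rw [← ENNReal.ofReal_rpow_of_nonneg (by positivity) (by positivity)]
  gcongr ?_ ^ _
  have hre : ∀ t : ℝ, 0 < t → rearrangement μ g t ≤
      ENNReal.ofReal ((∑ j ∈ J with t < (4:ℝ) ^ j, b j ^ q) ^ (1/q)) := by
    intro t ht
    set M := (∑ j ∈ J with t < (4:ℝ) ^ j, b j ^ q) ^ (1/q) with hM
    have hM0 : 0 ≤ M := Real.rpow_nonneg (Finset.sum_nonneg fun j _ => hb' j) _
    apply rearr_le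
    have hsub : {x | ENNReal.ofReal M < (‖g x‖₊ : ℝ≥0∞)} ⊆
        ⋃ j ∈ J.filter fun j => (4:ℝ) ^ j ≤ t, U j := by
      intro x hx
      have hx' : ENNReal.ofReal M < (‖g x‖₊ : ℝ≥0∞) := hx
      rw [← enorm_eq_nnnorm, ← ofReal_norm, ENNReal.ofReal_lt_ofReal_iff_of_nonneg hM0] at hx'
      obtain ⟨j, hj, hbj, hxj⟩ := hg M hM0 x hx'
      simp only [mem_iUnion]
      refine ⟨j, ?_, hxj⟩
      rw [Finset.mem_filter]
      refine ⟨hj, ?_⟩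
      by_contra hlt
      push Not at hlt
      have : b j ^ q ≤ ∑ j ∈ J with t < (4:ℝ) ^ j, b j ^ q :=
        Finset.single_le_sum (f := fun j => b j ^ q) (fun j _ => hb' j)
          (Finset.mem_filter.2 ⟨hj, hlt⟩)
      have h2 := Real.rpow_le_rpow (hb' j) this (show 0 ≤ 1/q by positivity)
      rw [← Real.rpow_mul (hb j), mul_one_div_cancel hq0.ne', Real.rpow_one] at h2
      linarith
    calc distribFn μ g (ENNReal.ofReal M) ≤ _ := measure_mono hsub
      _ ≤ ∑ j ∈ J.filter fun j => (4:ℝ) ^ j ≤ t, μ (U j) := measure_biUnion_finset_le _ _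
      _ ≤ ∑ j ∈ J.filter fun j => (4:ℝ) ^ j ≤ t, ENNReal.ofReal (3/4 * 4 ^ j) :=
          Finset.sum_le_sum fun j hj => hU j (Finset.mem_filter.1 hj).1
      _ = ENNReal.ofReal (∑ j ∈ J.filter fun j => (4:ℝ) ^ j ≤ t, 3/4 * 4 ^ j) :=
          (ENNReal.ofReal_sum_of_nonneg fun j _ => by positivity).symm
      _ ≤ _ := ENNReal.ofReal_le_ofReal
          (sum_quarter' _ ht fun j hj => (Finset.mem_filter.1 hj).2)
  have hIntg : ∀ j : ℤ, IntegrableOn (fun t : ℝ => t ^ (q/p - 1)) (Ioc 0 ((4:ℝ)^j)) ∧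
      ∫ t in Ioc 0 ((4:ℝ)^j), t ^ (q/p - 1) = p / q * ((4:ℝ) ^ j) ^ (q/p) := by
    intro j
    have hpos : 0 < q / p := by positivity
    have hj : (0:ℝ) ≤ 4 ^ j := by positivity
    constructor
    · have := intervalIntegral.intervalIntegrable_rpow' (a := 0) (b := (4:ℝ)^j) (r := q/p - 1)
        (by linarith)
      rwa [intervalIntegrable_iff_integrableOn_Ioc_of_le hj] at this
    · rw [← intervalIntegral.integral_of_le hj, integral_rpow (Or.inl (by linarith)), sub_add_cancel,
        Real.zero_rpow hpos.ne', sub_zero]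
      field_simp
  calc ∫⁻ t in Ioi (0:ℝ), (ENNReal.ofReal (t ^ (1 / p)) * rearrangement μ g t) ^ q / ENNReal.ofReal t
      ≤ ∫⁻ t in Ioi (0:ℝ), ∑ j ∈ J, (Ioc 0 ((4:ℝ)^j)).indicator
          (fun t => ENNReal.ofReal (b j ^ q * t ^ (q/p - 1))) t := by
        refine setLIntegral_mono' measurableSet_Ioi fun t ht => ?_
        have ht : 0 < t := ht
        set S := ∑ j ∈ J with t < (4:ℝ) ^ j, b j ^ q with hS
        have hS0 : 0 ≤ S := Finset.sum_nonneg fun j _ => hb' j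
        calc _ ≤ (ENNReal.ofReal (t ^ (1 / p)) * ENNReal.ofReal (S ^ (1/q))) ^ q / ENNReal.ofReal t := by
              gcongr
              exact hre t ht
          _ = ENNReal.ofReal (S * t ^ (q/p - 1)) := by
              rw [← ENNReal.ofReal_mul (by positivity), ENNReal.ofReal_rpow_of_nonneg (by positivity) hq0.le,
                ← ENNReal.ofReal_div_of_pos ht, Real.mul_rpow (by positivity) (by positivity),
                ← Real.rpow_mul ht.le, ← Real.rpow_mul hS0, one_div_mul_cancel hq0.ne', Real.rpow_one,
                Real.rpow_sub ht, Real.rpow_one, show 1 / p * q = q / p by ring]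
              congr 1; ring
          _ = ∑ j ∈ J with t < (4:ℝ) ^ j, ENNReal.ofReal (b j ^ q * t ^ (q/p - 1)) := by
              rw [hS, Finset.sum_mul, ENNReal.ofReal_sum_of_nonneg]
              exact fun j _ => mul_nonneg (hb' j) (by positivity)
          _ ≤ _ := by
              rw [Finset.sum_filter]
              refine Finset.sum_le_sum fun j _ => ?_
              split_ifs with h
              · rw [Set.indicator_of_mem (show t ∈ Ioc 0 ((4:ℝ)^j) from ⟨ht, h.le⟩)]
              · exact zero_le
    _ = ∑ j ∈ J, ∫⁻ t in Ioi (0:ℝ), (Ioc 0 ((4:ℝ)^j)).indicator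
          (fun t => ENNReal.ofReal (b j ^ q * t ^ (q/p - 1))) t := by
        rw [lintegral_finsetSum]
        intro j _
        refine Measurable.indicator ?_ measurableSet_Ioc
        exact ENNReal.measurable_ofReal.comp ((measurable_id.pow_const _).const_mul _)
    _ ≤ ∑ j ∈ J, ENNReal.ofReal (b j ^ q * (p / q * ((4:ℝ) ^ j) ^ (q/p))) := by
        refine Finset.sum_le_sum fun j _ => ?_
        refine (setLIntegral_le_lintegral _ _).trans ?_
        rw [lintegral_indicator measurableSet_Ioc, ← (hIntg j).2, ← integral_const_mul]
        refine le_of_eq (ofReal_integral_eq_lintegral_ofReal ((hIntg j).1.const_mul _) ?_).symm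
        filter_upwards [ae_restrict_mem measurableSet_Ioc] with t ht
        have := ht.1
        exact mul_nonneg (hb' j) (by positivity)
    _ = ENNReal.ofReal (p / q * ∑ j ∈ J, b j ^ q * ((4:ℝ) ^ j) ^ (q / p)) := by
        rw [← ENNReal.ofReal_sum_of_nonneg, Finset.mul_sum]
        · congr 1
          exact Finset.sum_congr rfl fun j _ => by ring
        · exact fun j _ => mul_nonneg (hb' j) (by positivity)

end Converse

section Molly
open scoped Convolution

lemma molly {d : ℕ} (J : Finset ℤ) {b : ℤ → ℝ} (hb : ∀ j, 0 ≤ b j) {D U : ℤ → Set (Ed d)}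
    (hD : ∀ j ∈ J, IsCompact (D j)) (hU : ∀ j ∈ J, IsOpen (U j))
    (hUb : ∀ j ∈ J, Bornology.IsBounded (U j)) (hDU : ∀ j ∈ J, D j ⊆ U j)
    {f₀ : Ed d → ℂ} (hf₀ : Measurable f₀)
    (hf : ∀ x, f₀ x ≠ 0 → ∃ j ∈ J, x ∈ D j ∧ ‖f₀ x‖ ≤ b j) {k : Ed d → ℂ} (hk : Continuous k) :
    ∃ g : ℕ → 𝓢(Ed d, ℂ),
      (∀ n, ∀ s : ℝ, 0 ≤ s → ∀ x, s < ‖g n x‖ → ∃ j ∈ J, s < b j ∧ x ∈ U j) ∧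
      Tendsto (fun n => ∫ x, k x * g n x) atTop (𝓝 (∫ x, k x * f₀ x)) := by
  have hr : ∃ r : ℝ, 0 < r ∧ ∀ j ∈ J, Metric.thickening r (D j) ⊆ U j := by
    clear hf
    induction J using Finset.induction_on with
    | empty => exact ⟨1, one_pos, by simp⟩
    | insert a J _ ih =>
      obtain ⟨r, hr, h⟩ := ih (fun j hj => hD j (Finset.mem_insert_of_mem hj))
        (fun j hj => hU j (Finset.mem_insert_of_mem hj))
        (fun j hj => hUb j (Finset.mem_insert_of_mem hj))
        (fun j hj => hDU j (Finset.mem_insert_of_mem hj))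
      have ha := Finset.mem_insert_self a J
      obtain ⟨r', hr', h'⟩ := (hD a ha).exists_thickening_subset_open (hU a ha) (hDU a ha)
      refine ⟨min r r', lt_min hr hr', fun j hj => ?_⟩
      rcases Finset.mem_insert.1 hj with rfl | hj
      · exact (Metric.thickening_mono (min_le_right _ _) _).trans h'
      · exact (Metric.thickening_mono (min_le_left _ _) _).trans (h j hj)
  obtain ⟨r, hr, hrU⟩ := hr
  set W : Set (Ed d) := ⋃ j ∈ J, U j with hW
  have hWb : Bornology.IsBounded W := by
    rw [hW, Bornology.isBounded_biUnion_finset]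
    exact hUb
  have hWm : MeasurableSet W := (isOpen_biUnion hU).measurableSet
  set B : ℝ := ∑ j ∈ J, b j with hB
  have hbB : ∀ j ∈ J, b j ≤ B := fun j hj => Finset.single_le_sum (fun i _ => hb i) hj
  have hB0 : 0 ≤ B := Finset.sum_nonneg fun j _ => hb j
  have hWfin : volume W ≠ ∞ := hWb.measure_lt_top.ne
  have hfint : Integrable f₀ := by
    have : Integrable (W.indicator fun _ => B) := 
      IntegrableOn.integrable_indicator (integrableOn_const hWfin) hWm
    refine this.mono' hf₀.aestronglyMeasurable (Eventually.of_forall fun x => ?_)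
    by_cases hx : f₀ x = 0
    · rw [hx, norm_zero]; exact indicator_nonneg (fun _ _ => hB0) x
    · obtain ⟨j, hj, hxj, hle⟩ := hf x hx
      rw [indicator_of_mem (show x ∈ W from mem_biUnion (s := (J : Set ℤ)) hj (hDU j hj hxj))]
      exact hle.trans (hbB j hj)
  have hrn : ∀ n : ℕ, 0 < r / (n + 1) := fun n => by positivity
  let φ : ℕ → ContDiffBump (0 : Ed d) := fun n =>
    ⟨r / (n + 1) / 2, r / (n + 1), by have := hrn n; linarith, by have := hrn n; linarith⟩
  have hφr : ∀ n, (φ n).rOut ≤ r := fun n => by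
    change r / (n + 1) ≤ r
    exact div_le_self hr.le (by have : (0:ℝ) ≤ n := Nat.cast_nonneg n; linarith)
  let G : ℕ → Ed d → ℂ := fun n => (φ n).normed volume ⋆[ContinuousLinearMap.lsmul ℝ ℝ, volume] f₀
  have hGb : ∀ n, ∀ s : ℝ, 0 ≤ s → ∀ x, s < ‖G n x‖ → ∃ j ∈ J, s < b j ∧ x ∈ U j := by
    intro n s hs x hx
    by_contra! hcon
    have := dist_convolution_le (μ := volume) (f := (φ n).normed volume) (g := f₀) (x₀ := x) (R := r)
      (z₀ := 0) hs (by
        rw [(φ n).support_normed_eq]; exact Metric.ball_subset_ball (hφr n)) (φ n).nonneg_normed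
      (φ n).integral_normed hf₀.aestronglyMeasurable (by
        intro y hy
        rw [dist_zero_right]
        by_cases h0 : f₀ y = 0
        · rw [h0, norm_zero]; exact hs
        · obtain ⟨j, hj, hyj, hle⟩ := hf y h0
          have hxU : x ∈ U j := hrU j hj (Metric.mem_thickening_iff.2
            ⟨y, hyj, by rw [dist_comm]; exact hy⟩)
          by_contra! hlt
          exact hcon j hj (hlt.trans_le hle) hxU)
    rw [dist_zero_right] at this
    exact absurd hx (not_lt.2 this)
  have hG0 : ∀ n x, x ∉ W → G n x = 0 := by
    intro n x hx
    by_contra h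
    obtain ⟨j, hj, -, hxj⟩ := hGb n 0 le_rfl x (norm_pos_iff.2 h)
    exact hx (mem_biUnion hj hxj)
  have hGB : ∀ n x, ‖G n x‖ ≤ B := by
    intro n x
    by_contra! h
    obtain ⟨j, hj, hlt, -⟩ := hGb n B hB0 x h
    exact absurd hlt (not_lt.2 (hbB j hj))
  have hGs : ∀ n, ContDiff ℝ ((⊤ : ℕ∞) : WithTop ℕ∞) (G n) := fun n =>
    (φ n).hasCompactSupport_normed.contDiff_convolution_left _ (φ n).contDiff_normed
      hfint.locallyIntegrable
  have hGc : ∀ n, HasCompactSupport (G n) := fun n =>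
    HasCompactSupport.intro hWb.isCompact_closure fun x hx =>
      hG0 n x fun h => hx (subset_closure h)
  refine ⟨fun n => (hGc n).toSchwartzMap (hGs n), fun n s hs x hx => hGb n s hs x hx, ?_⟩
  have hae := ContDiffBump.ae_convolution_tendsto_right_of_locallyIntegrable (μ := volume) (g := f₀)
    (φ := φ) (l := atTop) (K := 2) (by
      change Tendsto (fun n : ℕ => r / ((n:ℝ) + 1)) atTop (𝓝 0)
      simpa [div_eq_mul_inv] using (tendsto_one_div_add_atTop_nhds_zero_nat (𝕜 := ℝ)).const_mul r) (by
      refine Eventually.of_forall fun n => ?_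
      change r / (n + 1) ≤ 2 * (r / (n + 1) / 2)
      linarith) hfint.locallyIntegrable
  change Tendsto (fun n => ∫ x, k x * G n x) atTop (𝓝 (∫ x, k x * f₀ x))
  refine tendsto_integral_of_dominated_convergence (W.indicator fun x => ‖k x‖ * B) ?_ ?_ ?_ ?_
  · exact fun n => (hk.mul (hGs n).continuous).aestronglyMeasurable
  · refine IntegrableOn.integrable_indicator ?_ hWm
    exact ((hk.norm.mul continuous_const).continuousOn.integrableOn_compact
      hWb.isCompact_closure).mono_set subset_closure
  · intro n
    refine Eventually.of_forall fun x => ?_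
    by_cases hx : x ∈ W
    · rw [indicator_of_mem hx, norm_mul]
      exact mul_le_mul_of_nonneg_left (hGB n x) (norm_nonneg _)
    · rw [indicator_of_notMem hx, hG0 n x hx]; simp
  · filter_upwards [hae] with x hx
    exact hx.const_mul (k x)

end Molly

section Star

lemma star_ineq {d : ℕ} (hd : d ≠ 0) {p q : ℝ} (hp : 1 ≤ p) (hq : 1 ≤ q) {k : Ed d → ℂ}
    (hk : Continuous k) {C : ℝ} (hC : 0 ≤ C)
    (hbd : ∀ φ : 𝓢(Ed d, ℂ), ‖∫ x, k x * φ x‖ ≤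
      C * (lorentzNorm volume (ENNReal.ofReal p) (ENNReal.ofReal q) (⇑φ)).toReal)
    (J : Finset ℤ) {b c : ℤ → ℝ} (hb : ∀ j, 0 ≤ b j) (hc : ∀ j, 0 ≤ c j)
    (hJ : ∀ j ∈ J, ENNReal.ofReal (c j) < rearrangement volume k ((4:ℝ) ^ j)) :
    ∑ j ∈ J, b j * (c j * (1 / 4 * (4:ℝ) ^ j)) ≤
      C * (p / q * ∑ j ∈ J, b j ^ q * ((4:ℝ) ^ j) ^ (q / p)) ^ (1/q) := by
  have hex : ∀ j ∈ J, ∃ D U : Set (Ed d), D ⊆ {x | c j < ‖k x‖} ∧ IsCompact D ∧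
      volume D = ENNReal.ofReal (1/2 * 4 ^ j) ∧ D ⊆ U ∧ IsOpen U ∧ Bornology.IsBounded U ∧
      volume U ≤ ENNReal.ofReal (3/4 * 4 ^ j) := by
    intro j hj
    have h4 : (0:ℝ) < 4 ^ j := by positivity
    have h1 := lt_distrib (hJ j hj)
    have hset : {x | ENNReal.ofReal (c j) < (‖k x‖₊ : ℝ≥0∞)} = {x | c j < ‖k x‖} := by
      ext x
      rw [mem_setOf_eq, mem_setOf_eq, ← enorm_eq_nnnorm, ← ofReal_norm,
        ENNReal.ofReal_lt_ofReal_iff_of_nonneg (hc j)]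
    rw [distribFn, hset] at h1
    have h2 : ENNReal.ofReal (1/2 * 4 ^ j) < volume {x | c j < ‖k x‖} :=
      lt_of_le_of_lt (ENNReal.ofReal_le_ofReal (by linarith)) h1
    obtain ⟨D, hD, hDc, hDv⟩ := exists_compact_measure hd
      (measurableSet_lt measurable_const hk.norm.measurable) (by positivity) h2
    obtain ⟨U, hDU, hUo, hUv⟩ := D.exists_isOpen_lt_of_lt (ENNReal.ofReal (3/4 * 4 ^ j))
      (show volume D < _ by
        rw [hDv]; exact (ENNReal.ofReal_lt_ofReal_iff (by positivity)).2 (by linarith))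
    obtain ⟨R, hR⟩ := hDc.isBounded.subset_ball (0 : Ed d)
    exact ⟨D, U ∩ Metric.ball 0 R, hD, hDc, hDv, subset_inter hDU hR, hUo.inter Metric.isOpen_ball,
      Metric.isBounded_ball.subset inter_subset_right, (measure_mono inter_subset_left).trans hUv.le⟩
  choose! D U hDk hDc hDv hDU hUo hUb hUv using hex
  set E : ℤ → Set (Ed d) := fun j => D j \ ⋃ i ∈ J.filter (· < j), D i with hE
  have hDm : ∀ j ∈ J, MeasurableSet (D j) := fun j hj => (hDc j hj).measurableSet
  have hEm : ∀ j ∈ J, MeasurableSet (E j) := fun j hj => (hDm j hj).diff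
    (Finset.measurableSet_biUnion _ fun i hi => hDm i (Finset.mem_filter.1 hi).1)
  have hEdisj : ∀ i ∈ J, ∀ j ∈ J, ∀ x, x ∈ E i → x ∈ E j → i = j := by
    have key : ∀ i ∈ J, ∀ j ∈ J, ∀ x, x ∈ E i → x ∈ E j → ¬ i < j := by
      intro i hi j hj x hxi hxj hlt
      refine hxj.2 ?_
      simp only [mem_iUnion]
      exact ⟨i, Finset.mem_filter.2 ⟨hi, hlt⟩, hxi.1⟩
    intro i hi j hj x hxi hxj
    exact le_antisymm (not_lt.1 (key j hj i hi x hxj hxi)) (not_lt.1 (key i hi j hj x hxi hxj))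
  have hEfin : ∀ j ∈ J, volume (E j) ≠ ∞ := fun j hj =>
    ((measure_mono sdiff_subset).trans_lt (hDc j hj).measure_lt_top).ne
  have hEv : ∀ j ∈ J, 1 / 4 * (4:ℝ) ^ j ≤ (volume (E j)).toReal := by
    intro j hj
    have h1 : volume (D j) ≤ volume (E j) + ∑ i ∈ J.filter (· < j), ENNReal.ofReal (1/2 * 4 ^ i) := by
      calc volume (D j) ≤ volume (E j ∪ ⋃ i ∈ J.filter (· < j), D i) := by
            refine measure_mono fun x hx => ?_
            by_cases h : x ∈ ⋃ i ∈ J.filter (· < j), D i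
            · exact Or.inr h
            · exact Or.inl ⟨hx, h⟩
        _ ≤ _ := (measure_union_le _ _).trans (by
            gcongr
            refine (measure_biUnion_finset_le _ _).trans (Finset.sum_le_sum fun i hi => ?_)
            rw [hDv i (Finset.mem_filter.1 hi).1])
    rw [hDv j hj, ← ENNReal.ofReal_sum_of_nonneg (fun i _ => by positivity),
      ← ENNReal.ofReal_toReal (hEfin j hj), ← ENNReal.ofReal_add ENNReal.toReal_nonneg
      (Finset.sum_nonneg fun i _ => by positivity), ENNReal.ofReal_le_ofReal_iff
      (add_nonneg ENNReal.toReal_nonneg (Finset.sum_nonneg fun i _ => by positivity))] at h1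
    have h2 := sum_quarter (J.filter (· < j)) (j - 1) (fun i hi => by
      have := (Finset.mem_filter.1 hi).2; omega)
    have h3 : (4:ℝ) ^ (j - 1) = 4 ^ j / 4 := by rw [zpow_sub_one₀ (by norm_num)]; ring
    rw [← Finset.mul_sum] at h1 h2
    have h4 : (0:ℝ) < 4 ^ j := by positivity
    linarith
  set w : Ed d → ℝ := fun x => ∑ j ∈ J, (E j).indicator (fun _ => b j) x with hw
  have hwm : Measurable w := Finset.measurable_sum _ fun j hj => measurable_const.indicator (hEm j hj)
  have hwE : ∀ j ∈ J, ∀ x ∈ E j, w x = b j := by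
    intro j hj x hx
    simp only [hw]
    rw [Finset.sum_eq_single j]
    · exact indicator_of_mem hx _
    · intro i hi hij
      exact indicator_of_notMem (fun h => hij (hEdisj i hi j hj x h hx)) _
    · exact fun h => absurd hj h
  have hw0 : ∀ x, (∀ j ∈ J, x ∉ E j) → w x = 0 := fun x hx =>
    Finset.sum_eq_zero fun j hj => indicator_of_notMem (hx j hj) _
  set f₀ : Ed d → ℂ := fun x => (starRingEnd ℂ) (k x) / (‖k x‖ : ℂ) * (w x : ℂ) with hf₀
  have hfm : Measurable f₀ := by
    have h1 : Measurable fun x => (starRingEnd ℂ) (k x) := (continuous_conj.comp hk).measurable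
    have h2 : Measurable fun x => ((‖k x‖ : ℝ) : ℂ) := (continuous_ofReal.comp hk.norm).measurable
    exact (h1.div h2).mul (measurable_ofReal.comp hwm)
  have hfle : ∀ x, ‖f₀ x‖ ≤ |w x| := by
    intro x
    simp only [hf₀, norm_mul, norm_div, RCLike.norm_conj, norm_real, Real.norm_eq_abs, abs_norm]
    exact mul_le_of_le_one_left (abs_nonneg _) (div_self_le_one _)
  have hf : ∀ x, f₀ x ≠ 0 → ∃ j ∈ J, x ∈ D j ∧ ‖f₀ x‖ ≤ b j := by
    intro x hx
    by_cases h : ∃ j ∈ J, x ∈ E j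
    · obtain ⟨j, hj, hxj⟩ := h
      refine ⟨j, hj, hxj.1, (hfle x).trans ?_⟩
      rw [hwE j hj x hxj, abs_of_nonneg (hb j)]
    · push Not at h
      exact absurd (by simp [hf₀, hw0 x h]) hx
  obtain ⟨g, hg1, hg2⟩ := molly J hb hDc hUo hUb hDU hfm hf hk
  set X : ℝ := (p / q * ∑ j ∈ J, b j ^ q * ((4:ℝ) ^ j) ^ (q / p)) ^ (1/q) with hX
  have hX0 : 0 ≤ X := by
    refine Real.rpow_nonneg (mul_nonneg (by positivity) (Finset.sum_nonneg fun j _ => ?_)) _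
    exact mul_nonneg (Real.rpow_nonneg (hb j) _) (by positivity)
  have hlim : ‖∫ x, k x * f₀ x‖ ≤ C * X := by
    refine le_of_tendsto hg2.norm (Eventually.of_forall fun n => (hbd (g n)).trans ?_)
    refine mul_le_mul_of_nonneg_left ?_ hC
    exact ENNReal.toReal_le_of_le_ofReal hX0 (lorentz_step hp hq J hb hUv (hg1 n))
  have hkf : ∀ x, k x * f₀ x = ((∑ j ∈ J, (E j).indicator (fun x => b j * ‖k x‖) x : ℝ) : ℂ) := by
    intro x
    have h1 : ∑ j ∈ J, (E j).indicator (fun x => b j * ‖k x‖) x = w x * ‖k x‖ := by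
      simp only [hw, Finset.sum_mul]
      refine Finset.sum_congr rfl fun j _ => ?_
      by_cases hx : x ∈ E j <;> simp [hx]
    rw [h1]
    by_cases hk0 : k x = 0
    · simp [hk0]
    · have hn : (‖k x‖ : ℂ) ≠ 0 := by exact_mod_cast (norm_pos_iff.2 hk0).ne'
      simp only [hf₀]
      rw [← mul_assoc, mul_div_assoc', mul_conj, normSq_eq_norm_sq]
      push_cast
      field_simp
  have hki : ∀ j ∈ J, IntegrableOn (fun x => b j * ‖k x‖) (E j) := fun j hj =>
    ((continuous_const.mul hk.norm).continuousOn.integrableOn_compact (hDc j hj)).mono_set sdiff_subset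
  have hIntg : ∫ x, k x * f₀ x = ((∑ j ∈ J, ∫ x in E j, b j * ‖k x‖ : ℝ) : ℂ) := by
    refine (integral_congr_ae (Eventually.of_forall hkf)).trans (integral_complex_ofReal.trans ?_)
    rw [integral_finsetSum]
    · congr 1
      exact Finset.sum_congr rfl fun j hj => integral_indicator (hEm j hj)
    · exact fun j hj => (hki j hj).integrable_indicator (hEm j hj)
  rw [hIntg, norm_real] at hlim
  refine le_trans (Finset.sum_le_sum fun j hj => ?_) ((le_abs_self _).trans hlim)
  rw [integral_const_mul]
  refine mul_le_mul_of_nonneg_left ?_ (hb j)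
  refine (mul_le_mul_of_nonneg_left (hEv j hj) (hc j)).trans ?_
  have := setIntegral_ge_of_const_le_real (μ := volume) (hEm j hj) (hEfin j hj) (f := fun x => ‖k x‖) (c := c j)
    (fun x hx => (hDk j hj hx.1).le)
    ((hk.norm.continuousOn.integrableOn_compact (hDc j hj)).mono_set sdiff_subset)
  exact this

end Star

section Dual

lemma conv_holder_inf {d : ℕ} (hd : d ≠ 0) {p : ℝ} (hp : 1 ≤ p) {a : ℝ} (ha : 0 ≤ a)
    (hap : a + 1 / p = 1) {k : Ed d → ℂ} (hk : Continuous k) {C : ℝ} (hC : 0 ≤ C)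
    (hbd : ∀ φ : 𝓢(Ed d, ℂ), ‖∫ x, k x * φ x‖ ≤
      C * (lorentzNorm volume (ENNReal.ofReal p) (ENNReal.ofReal 1) (⇑φ)).toReal) :
    ⨆ t : Ioi (0:ℝ), ENNReal.ofReal ((t : ℝ) ^ a) * rearrangement volume k t < ∞ := by
  have hp0 : 0 < p := by linarith
  refine lt_of_le_of_lt (iSup_le (a := ENNReal.ofReal (4 ^ a * (4 * C * p))) ?_) ENNReal.ofReal_lt_top
  rintro ⟨t, ht⟩
  have ht : 0 < t := ht
  obtain ⟨j, hj1, hj2⟩ := exists_mem_Ico_zpow (y := (4:ℝ)) ht (by norm_num)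
  have h4 : (0:ℝ) < 4 ^ j := by positivity
  have hR : rearrangement volume k ((4:ℝ) ^ j) ≤ ENNReal.ofReal (4 * C * p / ((4:ℝ) ^ j) ^ a) := by
    refine le_of_forall_lt fun c' hc' => ?_
    obtain ⟨c'', h1, h2⟩ := exists_between hc'
    refine h1.trans_le ?_
    have hne : c'' ≠ ∞ := h2.ne_top
    rw [← ENNReal.ofReal_toReal hne] at h2 ⊢
    refine ENNReal.ofReal_le_ofReal ?_
    have := star_ineq hd hp le_rfl hk hC hbd {j} (b := fun _ => 1) (c := fun _ => c''.toReal)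
      (fun _ => zero_le_one) (fun _ => ENNReal.toReal_nonneg) (by simpa using h2)
    simp only [Finset.sum_singleton, one_mul, div_one, Real.rpow_one] at this
    rw [le_div_iff₀ (by positivity)]
    have he : (4:ℝ) ^ j = ((4:ℝ) ^ j) ^ a * ((4:ℝ) ^ j) ^ (1 / p) := by
      rw [← Real.rpow_add h4, hap, Real.rpow_one]
    set X := ((4:ℝ) ^ j) ^ a
    set Y := ((4:ℝ) ^ j) ^ (1 / p) with hY
    have hY0 : 0 < Y := by positivity
    rw [he] at this
    have h5 : (c''.toReal * X) * Y ≤ (4 * C * p) * Y := by linarith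
    exact le_of_mul_le_mul_right h5 hY0
  calc ENNReal.ofReal (t ^ a) * rearrangement volume k t
      ≤ ENNReal.ofReal (4 ^ a * ((4:ℝ) ^ j) ^ a) * ENNReal.ofReal (4 * C * p / ((4:ℝ) ^ j) ^ a) := by
        gcongr
        · rw [← Real.mul_rpow (by norm_num) h4.le]
          refine Real.rpow_le_rpow ht.le ?_ ha
          rw [zpow_add_one₀ (by norm_num)] at hj2
          linarith
        · exact (rearr_antitone k hj1).trans hR
    _ = ENNReal.ofReal (4 ^ a * (4 * C * p)) := by
        rw [← ENNReal.ofReal_mul (by positivity)]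
        congr 1
        have : ((4:ℝ) ^ j) ^ a ≠ 0 := by positivity
        field_simp

lemma conv_holder_A {d : ℕ} (hd : d ≠ 0) {p q r : ℝ} (hp : 1 ≤ p) (hqr : q.HolderConjugate r)
    {a : ℝ} (hap : a + 1 / p = 1) {k : Ed d → ℂ} (hk : Continuous k) {C : ℝ} (hC : 0 ≤ C)
    (hbd : ∀ φ : 𝓢(Ed d, ℂ), ‖∫ x, k x * φ x‖ ≤
      C * (lorentzNorm volume (ENNReal.ofReal p) (ENNReal.ofReal q) (⇑φ)).toReal)
    (J : Finset ℤ) {c : ℤ → ℝ} (hc : ∀ j, 0 ≤ c j)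
    (hJ : ∀ j ∈ J, ENNReal.ofReal (c j) < rearrangement volume k ((4:ℝ) ^ j)) :
    ∑ j ∈ J, (((4:ℝ) ^ j) ^ a * c j) ^ r ≤ (4 * C * (p / q) ^ (1 / q)) ^ r := by
  have hp0 : 0 < p := by linarith
  have hq1 := hqr.lt
  have hq0 : 0 < q := hqr.pos
  have hr0 : 0 < r := hqr.symm.pos
  have hr1 : 1 < r := hqr.symm.lt
  have hrq : (r - 1) * q = r := hqr.symm.sub_one_mul_conj
  set A := ∑ j ∈ J, (((4:ℝ) ^ j) ^ a * c j) ^ r with hA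
  have hA0 : 0 ≤ A := Finset.sum_nonneg fun j _ =>
    Real.rpow_nonneg (mul_nonneg (by positivity) (hc j)) _
  have key := star_ineq hd hp hq1.le hk hC hbd J
    (b := fun j => ((4:ℝ) ^ j) ^ (a * r - 1) * c j ^ (r - 1)) (c := c)
    (fun j => mul_nonneg (by positivity) (Real.rpow_nonneg (hc j) _)) hc hJ
  have e1 : ∑ j ∈ J, ((4:ℝ) ^ j) ^ (a * r - 1) * c j ^ (r - 1) * (c j * (1 / 4 * (4:ℝ) ^ j)) =
      A / 4 := by
    rw [hA, Finset.sum_div]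
    refine Finset.sum_congr rfl fun j _ => ?_
    have h4 : (0:ℝ) < 4 ^ j := by positivity
    rw [Real.mul_rpow (by positivity) (hc j), ← Real.rpow_mul h4.le]
    have h1 : c j ^ (r - 1) * c j = c j ^ r := by
      rcases (hc j).eq_or_lt with h | h
      · rw [← h, mul_zero, Real.zero_rpow hr0.ne']
      · rw [Real.rpow_sub_one h.ne', div_mul_cancel₀ _ h.ne']
    have h2 : ((4:ℝ) ^ j) ^ (a * r - 1) * (4:ℝ) ^ j = ((4:ℝ) ^ j) ^ (a * r) := by
      rw [Real.rpow_sub_one h4.ne', div_mul_cancel₀ _ h4.ne']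
    rw [← h1, ← h2]; ring
  have e2 : ∑ j ∈ J, (((4:ℝ) ^ j) ^ (a * r - 1) * c j ^ (r - 1)) ^ q * ((4:ℝ) ^ j) ^ (q / p) = A := by
    rw [hA]
    refine Finset.sum_congr rfl fun j _ => ?_
    have h4 : (0:ℝ) < 4 ^ j := by positivity
    rw [Real.mul_rpow (by positivity) (hc j), ← Real.rpow_mul h4.le,
      Real.mul_rpow (by positivity) (Real.rpow_nonneg (hc j) _), ← Real.rpow_mul h4.le,
      ← Real.rpow_mul (hc j), hrq, mul_right_comm, ← Real.rpow_add h4]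
    congr 2
    have : q / p = q * (1 / p) := by ring
    rw [this, show 1 / p = 1 - a by linarith]
    linear_combination a * hrq
  rw [e1, e2] at key
  rcases hA0.eq_or_lt with h0 | hpos
  · rw [← h0]; positivity
  have h3 : A ^ (1 / r) ≤ 4 * C * (p / q) ^ (1 / q) := by
    rw [Real.mul_rpow (by positivity) hA0] at key
    have h5 : A = A ^ (1 / r) * A ^ (1 / q) := by
      rw [← Real.rpow_add hpos]
      have := hqr.inv_add_inv_eq_one
      rw [one_div, one_div, add_comm, this, Real.rpow_one]
    have h6 : 0 < A ^ (1 / q) := by positivity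
    refine le_of_mul_le_mul_right ?_ h6
    rw [← h5]; linarith
  have h7 := Real.rpow_le_rpow (by positivity) h3 hr0.le
  rwa [← Real.rpow_mul hA0, one_div_mul_cancel hr0.ne', Real.rpow_one] at h7

lemma conv_holder_sum {d : ℕ} (hd : d ≠ 0) {p q r : ℝ} (hp : 1 ≤ p) (hqr : q.HolderConjugate r)
    {a : ℝ} (hap : a + 1 / p = 1) {k : Ed d → ℂ} (hk : Continuous k) {C : ℝ} (hC : 0 ≤ C)
    (hbd : ∀ φ : 𝓢(Ed d, ℂ), ‖∫ x, k x * φ x‖ ≤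
      C * (lorentzNorm volume (ENNReal.ofReal p) (ENNReal.ofReal q) (⇑φ)).toReal)
    (J : Finset ℤ) :
    ∑ j ∈ J, (ENNReal.ofReal (((4:ℝ) ^ j) ^ a) * rearrangement volume k ((4:ℝ) ^ j)) ^ r ≤
      ENNReal.ofReal ((4 * C * (p / q) ^ (1 / q)) ^ r) := by
  have hr0 : 0 < r := hqr.symm.pos
  have hu : ∀ j : ℤ, ∃ u : ℕ → ℝ≥0∞, (rearrangement volume k ((4:ℝ) ^ j) ≠ 0 →
      ∀ n, u n < rearrangement volume k ((4:ℝ) ^ j)) ∧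
      Tendsto u atTop (𝓝 (rearrangement volume k ((4:ℝ) ^ j))) := by
    intro j
    by_cases h : rearrangement volume k ((4:ℝ) ^ j) = 0
    · exact ⟨fun _ => 0, fun h' => absurd h h', by rw [h]; exact tendsto_const_nhds⟩
    · obtain ⟨u, -, hu, ht⟩ := exists_seq_strictMono_tendsto' (pos_iff_ne_zero.2 h)
      exact ⟨u, fun _ n => (hu n).2, ht⟩
  choose u hu1 hu2 using hu
  set J' := J.filter fun j => rearrangement volume k ((4:ℝ) ^ j) ≠ 0 with hJ'
  have hsum : ∑ j ∈ J, (ENNReal.ofReal (((4:ℝ) ^ j) ^ a) * rearrangement volume k ((4:ℝ) ^ j)) ^ r =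
      ∑ j ∈ J', (ENNReal.ofReal (((4:ℝ) ^ j) ^ a) * rearrangement volume k ((4:ℝ) ^ j)) ^ r := by
    symm
    refine Finset.sum_subset (Finset.filter_subset _ _) fun j hj hj' => ?_
    have : rearrangement volume k ((4:ℝ) ^ j) = 0 := by
      by_contra h
      exact hj' (Finset.mem_filter.2 ⟨hj, h⟩)
    rw [this, mul_zero, ENNReal.zero_rpow_of_pos hr0]
  rw [hsum]
  have hlim : Tendsto (fun n => ∑ j ∈ J', (ENNReal.ofReal (((4:ℝ) ^ j) ^ a) * u j n) ^ r) atTop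
      (𝓝 (∑ j ∈ J', (ENNReal.ofReal (((4:ℝ) ^ j) ^ a) * rearrangement volume k ((4:ℝ) ^ j)) ^ r)) := by
    refine tendsto_finset_sum _ fun j _ => ?_
    exact (ENNReal.continuous_rpow_const.tendsto _).comp
      (ENNReal.Tendsto.const_mul (hu2 j) (Or.inr ENNReal.ofReal_ne_top))
  refine le_of_tendsto hlim (Eventually.of_forall fun n => ?_)
  have hlt : ∀ j ∈ J', u j n < rearrangement volume k ((4:ℝ) ^ j) := fun j hj =>
    hu1 j (Finset.mem_filter.1 hj).2 n
  have hA := conv_holder_A hd hp hqr hap hk hC hbd J' (c := fun j => (u j n).toReal)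
    (fun j => ENNReal.toReal_nonneg) (fun j hj => by
      rw [ENNReal.ofReal_toReal (hlt j hj).ne_top]; exact hlt j hj)
  refine le_trans (le_of_eq ?_) (ENNReal.ofReal_le_ofReal hA)
  rw [ENNReal.ofReal_sum_of_nonneg fun j _ => by positivity]
  refine Finset.sum_congr rfl fun j hj => ?_
  rw [← ENNReal.ofReal_rpow_of_nonneg (by positivity) hr0.le, ENNReal.ofReal_mul (by positivity),
    ENNReal.ofReal_toReal (hlt j hj).ne_top]

lemma conv_holder {d : ℕ} (hd : d ≠ 0) {p q : ℝ} (hp : 1 ≤ p) (hq : 1 ≤ q) {p' q' : ℝ≥0∞}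
    (hp' : 1 / ENNReal.ofReal p + 1 / p' = 1) (hq' : 1 / ENNReal.ofReal q + 1 / q' = 1)
    {k : Ed d → ℂ} (hk : Continuous k) {C : ℝ} (hC : 0 ≤ C)
    (hbd : ∀ φ : 𝓢(Ed d, ℂ), ‖∫ x, k x * φ x‖ ≤
      C * (lorentzNorm volume (ENNReal.ofReal p) (ENNReal.ofReal q) (⇑φ)).toReal) :
    lorentzNorm volume p' q' k < ∞ := by
  have hpr : (1 / ENNReal.ofReal p).toReal = 1 / p := by
    rw [ENNReal.toReal_div, ENNReal.toReal_ofReal (by linarith)]; simp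
  have hap := conj_toReal hp hp'
  rw [hpr] at hap
  set a := (1 / p').toReal with ha
  have ha0 : 0 ≤ a := ENNReal.toReal_nonneg
  rcases conj_inf hq hq' with ⟨rfl, rfl⟩ | ⟨hq1, hqt, hqr⟩
  · rw [lorentzNorm, if_pos rfl]
    exact conv_holder_inf hd hp ha0 hap hk hC hbd
  · rw [lorentzNorm, if_neg hqt]
    set r := q'.toReal with hr
    have hr0 : 0 < r := hqr.symm.pos
    refine ENNReal.rpow_lt_top_of_nonneg (by positivity) (ne_of_lt ?_)
    have hsum := conv_holder_sum hd hp hqr hap hk hC hbd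
    set B := ENNReal.ofReal ((4 * C * (p / q) ^ (1 / q)) ^ r) with hB
    have hsub : Ioi (0:ℝ) ⊆ ⋃ j : ℤ, Ico ((4:ℝ) ^ j) (4 ^ (j + 1)) := by
      intro t ht
      obtain ⟨j, hj⟩ := exists_mem_Ico_zpow (y := (4:ℝ)) (show 0 < t from ht) (by norm_num)
      exact mem_iUnion.2 ⟨j, hj⟩
    set M : ℝ≥0∞ := ENNReal.ofReal (3 * (4 ^ a) ^ r) with hM
    calc ∫⁻ t in Ioi (0:ℝ), (ENNReal.ofReal (t ^ a) * rearrangement volume k t) ^ r / ENNReal.ofReal t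
        ≤ ∫⁻ t in ⋃ j : ℤ, Ico ((4:ℝ) ^ j) (4 ^ (j + 1)),
          (ENNReal.ofReal (t ^ a) * rearrangement volume k t) ^ r / ENNReal.ofReal t :=
          lintegral_mono_set hsub
      _ ≤ ∑' j : ℤ, ∫⁻ t in Ico ((4:ℝ) ^ j) (4 ^ (j + 1)),
          (ENNReal.ofReal (t ^ a) * rearrangement volume k t) ^ r / ENNReal.ofReal t :=
          lintegral_iUnion_le _ _
      _ ≤ ∑' j : ℤ, M *
          (ENNReal.ofReal (((4:ℝ) ^ j) ^ a) * rearrangement volume k ((4:ℝ) ^ j)) ^ r := by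
          refine ENNReal.tsum_le_tsum fun j => ?_
          have h4 : (0:ℝ) < 4 ^ j := by positivity
          have h41 : (4:ℝ) ^ (j + 1) = 4 * 4 ^ j := by rw [zpow_add_one₀ (by norm_num)]; ring
          set R := rearrangement volume k ((4:ℝ) ^ j) with hR
          calc _ ≤ ∫⁻ t in Ico ((4:ℝ) ^ j) (4 ^ (j + 1)),
                (ENNReal.ofReal (4 ^ a) * (ENNReal.ofReal (((4:ℝ) ^ j) ^ a) * R)) ^ r /
                  ENNReal.ofReal (4 ^ j) := by
                refine setLIntegral_mono' measurableSet_Ico fun t ht => ?_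
                have ht0 : 0 < t := h4.trans_le ht.1
                rw [← mul_assoc (ENNReal.ofReal (4 ^ a)), ← ENNReal.ofReal_mul (by positivity),
                  ← Real.mul_rpow (by norm_num) h4.le, ← h41]
                refine ENNReal.div_le_div (ENNReal.rpow_le_rpow (mul_le_mul' ?_ ?_) hr0.le)
                  (ENNReal.ofReal_le_ofReal ht.1)
                · exact ENNReal.ofReal_le_ofReal (Real.rpow_le_rpow ht0.le ht.2.le ha0)
                · exact rearr_antitone k ht.1
            _ = _ := by
                rw [setLIntegral_const, Real.volume_Ico, ENNReal.mul_rpow_of_nonneg _ _ hr0.le, hM,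
                  ENNReal.ofReal_rpow_of_nonneg (by positivity) hr0.le, h41]
                set Z := (ENNReal.ofReal (((4:ℝ) ^ j) ^ a) * R) ^ r
                rw [show (4:ℝ) * 4 ^ j - 4 ^ j = 3 * 4 ^ j by ring, ENNReal.ofReal_mul (p := 3) (by norm_num),
                  ENNReal.ofReal_mul (p := 3) (by norm_num), div_eq_mul_inv]
                set Y := ENNReal.ofReal ((4:ℝ) ^ j) with hY
                have hY1 : Y * Y⁻¹ = 1 := ENNReal.mul_inv_cancel
                  (by rw [hY]; simpa using h4) ENNReal.ofReal_ne_top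
                calc _ = ENNReal.ofReal 3 * ENNReal.ofReal ((4 ^ a) ^ r) * Z * (Y * Y⁻¹) := by ring
                  _ = _ := by rw [hY1, mul_one]
      _ = M * ∑' j : ℤ,
          (ENNReal.ofReal (((4:ℝ) ^ j) ^ a) * rearrangement volume k ((4:ℝ) ^ j)) ^ r :=
          ENNReal.tsum_mul_left
      _ ≤ M * B := by
          gcongr
          rw [ENNReal.tsum_eq_iSup_sum]
          exact iSup_le hsum
      _ < ∞ := ENNReal.mul_lt_top ENNReal.ofReal_lt_top ENNReal.ofReal_lt_top

lemma part_i_fwd {d : ℕ} (hd : d ≠ 0) {p q : ℝ} (hp : 1 ≤ p) (hq : 1 ≤ q) {p' q' : ℝ≥0∞}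
    (hp' : 1 / ENNReal.ofReal p + 1 / p' = 1) (hq' : 1 / ENNReal.ofReal q + 1 / q' = 1)
    (K : 𝓢(Ed d, ℂ) →L[ℂ] ℂ)
    (hKhat : ∃ R : ℝ, 0 < R ∧ ∀ g : 𝓢(Ed d, ℂ),
      (∀ ξ ∈ Metric.closedBall (0 : Ed d) R, g ξ = 0) →
      K (SchwartzMap.fourierTransformCLM ℂ g) = 0)
    (h : ∀ g : 𝓢(Ed d, ℂ), ∃ C : ℝ, ∀ f : 𝓢(Ed d, ℂ),
        ‖∫ x : Ed d, TK K f x * g x‖ ≤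
          C * (lorentzNorm volume (ENNReal.ofReal p) (ENNReal.ofReal q) (⇑f)).toReal) :
    ∃ k : Ed d → ℂ, Measurable k ∧ lorentzNorm volume p' q' k < ∞ ∧
          ∀ g : 𝓢(Ed d, ℂ), K g = ∫ x : Ed d, k x * g x := by
  obtain ⟨η, hη⟩ := K_reproduce K hKhat
  obtain ⟨C, hC⟩ := h η
  have hrr : ∀ φ : 𝓢(Ed d, ℂ), reflectTranslate 0 (reflectTranslate 0 φ) = φ := by
    intro φ; ext x; simp [reflectTranslate_apply]
  have hcomm : ∀ φ : 𝓢(Ed d, ℂ), SchwartzMap.convolution (ContinuousLinearMap.mul ℂ ℂ) φ η =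
      SchwartzMap.convolution (ContinuousLinearMap.mul ℂ ℂ) η φ := by
    intro φ
    have := SchwartzMap.convolution_flip (ContinuousLinearMap.mul ℂ ℂ) φ η
    have hfl : (ContinuousLinearMap.mul ℂ ℂ).flip = ContinuousLinearMap.mul ℂ ℂ := by
      ext; simp
    rw [hfl] at this
    first | exact this | exact this.symm
  have hrep : ∀ φ : 𝓢(Ed d, ℂ), K φ = ∫ x, TK K (reflectTranslate 0 η) x * φ x := by
    intro φ
    rw [TK_swap, hrr, hcomm, ← hη]
  have hbound : ∀ φ : 𝓢(Ed d, ℂ), ‖K φ‖ ≤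
      C * (lorentzNorm volume (ENNReal.ofReal p) (ENNReal.ofReal q) (⇑φ)).toReal := by
    intro φ
    have h1 := hC (reflectTranslate 0 φ)
    rw [TK_swap, hrr, ← hη] at h1
    have h2 : (⇑(reflectTranslate 0 φ) : Ed d → ℂ) = fun x => φ ((0 : Ed d) - x) := by
      funext x; rw [reflectTranslate_apply]
    have h3 := lorentz_comp_mp (μ := (volume : Measure (Ed d))) (ENNReal.ofReal p) (ENNReal.ofReal q) (f := φ)
      φ.continuous.measurable (Measure.measurePreserving_sub_left (volume : Measure (Ed d)) 0)
    rw [h2] at h1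
    rwa [h3] at h1
  refine ⟨TK K (reflectTranslate 0 η), (TK_continuous _ _).measurable, ?_, hrep⟩
  refine conv_holder hd hp hq hp' hq' (TK_continuous _ _) (le_max_right C 0) fun φ => ?_
  rw [← hrep]
  exact (hbound φ).trans (mul_le_mul_of_nonneg_right (le_max_left _ _) ENNReal.toReal_nonneg)

end Dual

/-- Lemma (convolution operators with band-limited kernels on Lorentz spaces).
Let `K` be a tempered distribution on `ℝ^d` whose Fourier transform has compact support and
let `T_K f = f * K`. Then:
(i) `T_K` extends to a continuous linear operator from `L^{p,q}` to tempered distributions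
iff `K ∈ L^{p',q'}`;
(ii) if `K` is (represented by) a function `k ∈ L^{p',q'}`, then for every `f ∈ L^{p,q}` the
maximal function `x ↦ sup_{t>0} |t^d k(t·) * f(x)|` is Borel measurable. -/
theorem statement6 (d : ℕ) (hd : 1 ≤ d)
    (p q : ℝ) (hp : 1 ≤ p) (hq : 1 ≤ q)
    (p' q' : ℝ≥0∞)
    (hp' : 1 / ENNReal.ofReal p + 1 / p' = 1)
    (hq' : 1 / ENNReal.ofReal q + 1 / q' = 1)
    (K : 𝓢(Ed d, ℂ) →L[ℂ] ℂ)
    (hKhat : ∃ R : ℝ, 0 < R ∧ ∀ g : 𝓢(Ed d, ℂ),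
      (∀ ξ ∈ Metric.closedBall (0 : Ed d) R, g ξ = 0) →
      K (SchwartzMap.fourierTransformCLM ℂ g) = 0) :
    ((∀ g : 𝓢(Ed d, ℂ), ∃ C : ℝ, ∀ f : 𝓢(Ed d, ℂ),
        ‖∫ x : Ed d, TK K f x * g x‖ ≤
          C * (lorentzNorm volume (ENNReal.ofReal p) (ENNReal.ofReal q) (⇑f)).toReal)
      ↔ (∃ k : Ed d → ℂ, Measurable k ∧ lorentzNorm volume p' q' k < ∞ ∧
          ∀ g : 𝓢(Ed d, ℂ), K g = ∫ x : Ed d, k x * g x))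
    ∧
    (∀ k : Ed d → ℂ, Measurable k → lorentzNorm volume p' q' k < ∞ →
      (∀ g : 𝓢(Ed d, ℂ), K g = ∫ x : Ed d, k x * g x) →
      ∀ f : Ed d → ℂ, Measurable f →
        lorentzNorm volume (ENNReal.ofReal p) (ENNReal.ofReal q) f < ∞ →
        Measurable (fun x : Ed d => ⨆ (t : ℝ) (_ : 0 < t),
          (‖∫ y : Ed d, ((t ^ d : ℝ) : ℂ) * k (t • y) * f (x - y)‖₊ : ℝ≥0∞))) := by
  refine ⟨⟨fun h => part_i_fwd (by omega) hp hq hp' hq' K hKhat h, ?_⟩, ?_⟩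
  · rintro ⟨k, hk, hkN, hK⟩ g
    exact part_i_rev (by omega) hp hq hp' hq' K hk hkN hK g
  · intro k hk hkN _ f hf hfN
    exact part_ii hp hq hp' hq' hk hkN hf hfN

end
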